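/- (Smooth pasting criterion.) Let K > 0 and assume either r > 0, or r = 0 and ℙ(lim_{t → ∞} X_t = ∞) = 1. Let v(x) = sup_{τ} E[e^{−r τ} (K − e^{x + X_τ})^+ 1_{{τ < ∞}}] (supremum over all stopping times) and x* = log(K E[e^{X̲_{e_r}}]). Then v is differentiable at x* (equivalently, the left and right derivatives of v at x* agree, both equaling −e^{x*}) if and only if 0 is regular for (−∞, 0) for X, i.e., if and only if ℙ(τ_0^− = 0) = 1, where τ_0^− = inf{t ≥ 0 : X_t < 0}. -/

import Mathlib

open MeasureTheory ProbabilityTheory Set Filter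
open scoped ENNReal NNReal Classical

noncomputable section

namespace AKLevy

variable {Ω : Type*}

/-- Running supremum `X̄_t = sup_{0 ≤ s ≤ t} X_s` of a process. -/
def runSup (X : ℝ → Ω → ℝ) (t : ℝ) (ω : Ω) : ℝ :=
  sSup ((fun s => X s ω) '' Set.Icc 0 t)

/-- Running infimum `X̲_t = inf_{0 ≤ s ≤ t} X_s` of a process. -/
def runInf (X : ℝ → Ω → ℝ) (t : ℝ) (ω : Ω) : ℝ :=
  sInf ((fun s => X s ω) '' Set.Icc 0 t)

/-- All-time supremum `X̄_∞ = sup_{t ≥ 0} X_t`. -/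
def supAll (X : ℝ → Ω → ℝ) (ω : Ω) : ℝ :=
  sSup ((fun s => X s ω) '' Set.Ici 0)

/-- All-time infimum `X̲_∞ = inf_{t ≥ 0} X_t`. -/
def infAll (X : ℝ → Ω → ℝ) (ω : Ω) : ℝ :=
  sInf ((fun s => X s ω) '' Set.Ici 0)

/-- `X` is a real-valued Lévy process with respect to the filtration `ℱ`,
on a filtered probability space satisfying the usual conditions. -/
structure IsLevy [m0 : MeasurableSpace Ω] (P : Measure Ω) (ℱ : Filtration ℝ m0)
    (X : ℝ → Ω → ℝ) : Prop where
  isProb : IsProbabilityMeasure P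
  adapted : ∀ t : ℝ, 0 ≤ t → StronglyMeasurable[ℱ t] (X t)
  zero : ∀ᵐ ω ∂P, X 0 ω = 0
  rightCont : ∀ ω, ∀ t : ℝ, 0 ≤ t → ContinuousWithinAt (fun s => X s ω) (Set.Ici t) t
  leftLim : ∀ ω, ∀ t : ℝ, 0 < t →
    ∃ l : ℝ, Tendsto (fun s => X s ω) (nhdsWithin t (Set.Iio t)) (nhds l)
  indepIncrements : ∀ s t : ℝ, 0 ≤ s → s ≤ t →
    Indep (MeasurableSpace.comap (fun ω => X t ω - X s ω) inferInstance) (ℱ s) P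
  stationary : ∀ s t : ℝ, 0 ≤ s → s ≤ t →
    Measure.map (fun ω => X t ω - X s ω) P = Measure.map (X (t - s)) P
  filtRightCont : ∀ t : ℝ, (ℱ t : MeasurableSpace Ω) = ⨅ s ∈ Set.Ioi t, (ℱ s : MeasurableSpace Ω)
  complete : ∀ N : Set Ω, MeasurableSet N → P N = 0 → MeasurableSet[ℱ 0] N

/-- `τ_x^+ < ∞`: the process passes strictly above level `x` at some nonnegative time. -/
def hitsAbove (X : ℝ → Ω → ℝ) (x : ℝ) (ω : Ω) : Prop := ∃ t, 0 ≤ t ∧ x < X t ω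

/-- First passage time above `x`:  `τ_x^+ = inf {t ≥ 0 : X_t > x}` (junk value if never). -/
def tauAbove (X : ℝ → Ω → ℝ) (x : ℝ) (ω : Ω) : ℝ := sInf {t : ℝ | 0 ≤ t ∧ x < X t ω}

/-- `τ_x^- < ∞`: the process passes strictly below level `x` at some nonnegative time. -/
def hitsBelow (X : ℝ → Ω → ℝ) (x : ℝ) (ω : Ω) : Prop := ∃ t, 0 ≤ t ∧ X t ω < x

/-- First passage time below `x`:  `τ_x^- = inf {t ≥ 0 : X_t < x}` (junk value if never). -/
def tauBelow (X : ℝ → Ω → ℝ) (x : ℝ) (ω : Ω) : ℝ := sInf {t : ℝ | 0 ≤ t ∧ X t ω < x}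

/-- The `[0,∞]`-valued first passage time `σ_x = inf { t ≥ 0 : x + X_t < y }`, with `inf ∅ = ∞`. -/
def hitBelowE (X : ℝ → Ω → ℝ) (y x : ℝ) (ω : Ω) : ℝ≥0∞ :=
  if ∃ t, 0 ≤ t ∧ x + X t ω < y then ENNReal.ofReal (sInf {t : ℝ | 0 ≤ t ∧ x + X t ω < y})
  else ∞

/-- The stopped clock `t ∧ σ_x` (real-valued), where `σ_x = inf{ t ≥ 0 : x + X_t < y}`. -/
def stoppedClock (X : ℝ → Ω → ℝ) (y x : ℝ) (t : ℝ) (ω : Ω) : ℝ :=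
  (min (ENNReal.ofReal t) (hitBelowE X y x ω)).toReal

/-- A `[0,∞]`-valued stopping time of the filtration `ℱ`. -/
def IsStopTime [m0 : MeasurableSpace Ω] (ℱ : Filtration ℝ m0) (τ : Ω → ℝ≥0∞) : Prop :=
  ∀ t : ℝ, 0 ≤ t → MeasurableSet[ℱ t] {ω | τ ω ≤ ENNReal.ofReal t}

/-- Discounted payoff `e^{-rτ} G(x + X_τ)` at a `[0,∞]`-valued time `τ`, set to `0` on `{τ = ∞}`. -/
def stopPayoff (X : ℝ → Ω → ℝ) (r x : ℝ) (G : ℝ → ℝ) (τ : Ω → ℝ≥0∞) (ω : Ω) : ℝ :=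
  if τ ω ≠ ∞ then Real.exp (-(r * (τ ω).toReal)) * G (x + X ((τ ω).toReal) ω) else 0

/-- Discounted American put payoff `e^{-rτ}(K - e^{x + X_τ})^+ 1_{τ < ∞}`. -/
def putPayoff (X : ℝ → Ω → ℝ) (r K x : ℝ) (τ : Ω → ℝ≥0∞) (ω : Ω) : ℝ :=
  stopPayoff X r x (fun z => max (K - Real.exp z) 0) τ ω

/-- Value function `v(x) = sup_τ E[e^{-rτ}(K - e^{x+X_τ})^+ 1_{τ<∞}]`, the supremum
being over all `[0,∞]`-valued stopping times of `ℱ`. -/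
def putValue [m0 : MeasurableSpace Ω] (P : Measure Ω) (ℱ : Filtration ℝ m0)
    (X : ℝ → Ω → ℝ) (r K x : ℝ) : ℝ :=
  ⨆ τ : {τ : Ω → ℝ≥0∞ // IsStopTime ℱ τ}, ∫ ω, putPayoff X r K x τ.1 ω ∂P

/-- `m = E[e^{X̲_{e_r}}]`, where `e_r` is an independent exponential time of rate `r > 0`,
and `e_0 = ∞`. -/
def mInf [m0 : MeasurableSpace Ω] (P : Measure Ω) (X : ℝ → Ω → ℝ) (r : ℝ) : ℝ :=
  if 0 < r then
    ∫ t in Set.Ioi (0 : ℝ), r * Real.exp (-(r * t)) * (∫ ω, Real.exp (runInf X t ω) ∂P)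
  else ∫ ω, Real.exp (infAll X ω) ∂P

/-- `P(X̲_{e_r} = 0)`, where `e_r` is an independent exponential time of rate `r > 0`,
and `e_0 = ∞`. -/
def atomZeroProb [m0 : MeasurableSpace Ω] (P : Measure Ω) (X : ℝ → Ω → ℝ) (r : ℝ) : ℝ :=
  if 0 < r then
    ∫ t in Set.Ioi (0 : ℝ), r * Real.exp (-(r * t)) * (P {ω | runInf X t ω = 0}).toReal
  else (P {ω | infAll X ω = 0}).toReal

/-- The event `{τ_0^- = 0}`: `0` is (pathwise) immediately reached from below, i.e.
`inf{t ≥ 0 : X_t < 0} = 0`. -/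
def regularBelow (X : ℝ → Ω → ℝ) : Set Ω :=
  {ω | ∀ ε > (0 : ℝ), ∃ t, 0 ≤ t ∧ t < ε ∧ X t ω < 0}

/-- `E[e^{-γ X̄_{e_α}}] = ∫_0^∞ α e^{-α t} E[e^{-γ X̄_t}] dt`. -/
def expSupLT [m0 : MeasurableSpace Ω] (P : Measure Ω) (X : ℝ → Ω → ℝ) (α γ : ℝ) : ℝ :=
  ∫ t in Set.Ioi (0 : ℝ), α * Real.exp (-(α * t)) * (∫ ω, Real.exp (-(γ * runSup X t ω)) ∂P)

/-- The function `h_{α,β}(x) = E[e^{-α σ_x + β (x + X_{σ_x})} 1_{σ_x < ∞}]`, where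
`σ_x = inf{t ≥ 0 : x + X_t < 0}`. -/
def hAB [m0 : MeasurableSpace Ω] (P : Measure Ω) (X : ℝ → Ω → ℝ) (α β : ℝ) (z : ℝ) : ℝ :=
  ∫ ω, (if hitsBelow X (-z) ω then
      Real.exp (-(α * tauBelow X (-z) ω) + β * (z + X (tauBelow X (-z) ω) ω)) else 0) ∂P

/-- `v_y(x) = E[e^{-r σ_x} (K - e^{x + X_{σ_x}})^+ 1_{σ_x<∞}]` where
`σ_x = inf{t ≥ 0 : x + X_t < y}`. -/
def vy [m0 : MeasurableSpace Ω] (P : Measure Ω) (X : ℝ → Ω → ℝ) (r K y : ℝ) (z : ℝ) : ℝ :=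
  ∫ ω, putPayoff X r K z (hitBelowE X y z) ω ∂P

/-- The process `f` (indexed by `t ≥ 0`) is a martingale with respect to `ℱ` and `P`. -/
def MartOn [m0 : MeasurableSpace Ω] (P : Measure Ω) (ℱ : Filtration ℝ m0)
    (f : ℝ → Ω → ℝ) : Prop :=
  (∀ t : ℝ, 0 ≤ t → StronglyMeasurable[ℱ t] (f t)) ∧
  (∀ t : ℝ, 0 ≤ t → Integrable (f t) P) ∧
  ∀ s t : ℝ, 0 ≤ s → s ≤ t → P[f t|ℱ s] =ᵐ[P] f s

/-- The process `f` (indexed by `t ≥ 0`) is a supermartingale w.r.t. `ℱ` and `P`. -/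
def SupermartOn [m0 : MeasurableSpace Ω] (P : Measure Ω) (ℱ : Filtration ℝ m0)
    (f : ℝ → Ω → ℝ) : Prop :=
  (∀ t : ℝ, 0 ≤ t → StronglyMeasurable[ℱ t] (f t)) ∧
  (∀ t : ℝ, 0 ≤ t → Integrable (f t) P) ∧
  ∀ s t : ℝ, 0 ≤ s → s ≤ t → P[f t|ℱ s] ≤ᵐ[P] f s

/-! ### The process observed on a grid -/

/-- The minimum of the increments `X_{(j+i)δ} - X_{jδ}` over `0 ≤ i ≤ k`. -/
def incMin (X : ℝ → Ω → ℝ) (δ : ℝ) : ℕ → ℕ → Ω → ℝ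
  | 0, _, _ => 0
  | k + 1, j, ω => min 0 (X (((j + 1 : ℕ) : ℝ) * δ) ω - X ((j : ℝ) * δ) ω + incMin X δ k (j + 1) ω)

/-- The law of the minimum of the first `k` steps of a random walk with step law `ρ`. -/
def walkMinLaw (ρ : Measure ℝ) : ℕ → Measure ℝ
  | 0 => Measure.dirac 0
  | k + 1 => (ρ.prod (walkMinLaw ρ k)).map (fun q => min 0 (q.1 + q.2))

instance walkMinLaw_isProbabilityMeasure (ρ : Measure ℝ) [IsProbabilityMeasure ρ] (k : ℕ) :
    IsProbabilityMeasure (walkMinLaw ρ k) := by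
  induction k with
  | zero => unfold walkMinLaw; infer_instance
  | succ k ih => unfold walkMinLaw; exact Measure.isProbabilityMeasure_map (by fun_prop)

theorem walkMinLaw_ae_nonpos (ρ : Measure ℝ) [IsProbabilityMeasure ρ] (k : ℕ) :
    ∀ᵐ y ∂(walkMinLaw ρ k), y ≤ 0 := by
  cases k with
  | zero =>
    unfold walkMinLaw
    exact (ae_dirac_iff measurableSet_Iic).2 le_rfl
  | succ k =>
    unfold walkMinLaw
    exact (ae_map_iff (by fun_prop) measurableSet_Iic).2 (Eventually.of_forall fun q => min_le_left _ _)

theorem le_incMin_iff (X : ℝ → Ω → ℝ) (δ : ℝ) (ω : Ω) (c : ℝ) (k j : ℕ) :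
    c ≤ incMin X δ k j ω ↔
      ∀ i ≤ k, c ≤ X (((j + i : ℕ) : ℝ) * δ) ω - X ((j : ℝ) * δ) ω := by
  induction k generalizing j c with
  | zero => simp [incMin]
  | succ k ih =>
    have h := ih (c - (X (((j + 1 : ℕ) : ℝ) * δ) ω - X ((j : ℝ) * δ) ω)) (j + 1)
    simp only [incMin, le_min_iff]
    rw [← sub_le_iff_le_add', h]
    constructor
    · rintro ⟨h0, h1⟩ i hi
      cases i with
      | zero => simpa using h0
      | succ i =>
        have := h1 i (by omega)
        rw [show j + (i + 1) = j + 1 + i by omega]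
        linarith
    · intro h1
      refine ⟨by simpa using h1 0 (by omega), fun i hi => ?_⟩
      have := h1 (i + 1) (by omega)
      rw [show j + 1 + i = j + (i + 1) by omega]
      linarith

theorem incMin_nonpos (X : ℝ → Ω → ℝ) (δ : ℝ) (ω : Ω) (k j : ℕ) : incMin X δ k j ω ≤ 0 := by
  simpa using (le_incMin_iff X δ ω _ k j).1 le_rfl 0 (by omega)

/-- The minimum of the process over the grid points `0, δ, …, kδ`. -/
def gridInf (X : ℝ → Ω → ℝ) (δ : ℝ) (k : ℕ) (ω : Ω) : ℝ := X 0 ω + incMin X δ k 0 ω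

theorem le_gridInf_iff (X : ℝ → Ω → ℝ) (δ : ℝ) (ω : Ω) (c : ℝ) (k : ℕ) :
    c ≤ gridInf X δ k ω ↔ ∀ i ≤ k, c ≤ X ((i : ℝ) * δ) ω := by
  unfold gridInf
  rw [← sub_le_iff_le_add', le_incMin_iff]
  simp

theorem gridInf_le_add_incMin (X : ℝ → Ω → ℝ) (δ : ℝ) (ω : Ω) (j k : ℕ) :
    gridInf X δ (j + k) ω ≤ X ((j : ℝ) * δ) ω + incMin X δ k j ω := by
  rw [← sub_le_iff_le_add', le_incMin_iff]
  intro i hi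
  have := (le_gridInf_iff X δ ω _ (j + k)).1 le_rfl (j + i) (by omega)
  linarith

theorem add_incMin_le_gridInf (X : ℝ → Ω → ℝ) (δ : ℝ) (ω : Ω) (j k : ℕ)
    (h : ∀ i < j, X ((j : ℝ) * δ) ω ≤ X ((i : ℝ) * δ) ω) :
    X ((j : ℝ) * δ) ω + incMin X δ k j ω ≤ gridInf X δ (j + k) ω := by
  rw [le_gridInf_iff]
  intro i hi
  rcases lt_or_ge i j with hij | hij
  · linarith [h i hij, incMin_nonpos X δ ω k j]
  · have := (le_incMin_iff X δ ω _ k j).1 le_rfl (i - j) (by omega)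
    rw [show j + (i - j) = i by omega] at this
    linarith

section Markov

variable [m0 : MeasurableSpace Ω] {P : Measure Ω} {ℱ : Filtration ℝ m0} {X : ℝ → Ω → ℝ}

theorem IsLevy.measurable (hX : IsLevy P ℱ X) {t : ℝ} (ht : 0 ≤ t) : Measurable (X t) :=
  (hX.adapted t ht).measurable.mono (ℱ.le t) le_rfl

theorem IsLevy.measurable_grid (hX : IsLevy P ℱ X) {δ : ℝ} (hδ : 0 < δ) {i j : ℕ} (hij : i ≤ j) :
    Measurable[ℱ ((j : ℝ) * δ)] (X ((i : ℝ) * δ)) :=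
  (hX.adapted _ (by positivity)).measurable.mono
    (ℱ.mono (mul_le_mul_of_nonneg_right (by exact_mod_cast hij) hδ.le)) le_rfl

theorem IsLevy.measurable_incMin (hX : IsLevy P ℱ X) {δ : ℝ} (hδ : 0 < δ) (k j : ℕ) :
    Measurable (incMin X δ k j) := by
  induction k generalizing j with
  | zero => exact measurable_const
  | succ k ih =>
    have h1 : Measurable (X (((j + 1 : ℕ) : ℝ) * δ)) := hX.measurable (by positivity)
    have h2 : Measurable (X ((j : ℝ) * δ)) := hX.measurable (by positivity)
    exact measurable_const.min ((h1.sub h2).add (ih (j + 1)))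

theorem IsLevy.measurable_gridInf (hX : IsLevy P ℱ X) {δ : ℝ} (hδ : 0 < δ) (k : ℕ) :
    Measurable (gridInf X δ k) :=
  (hX.measurable le_rfl).add (hX.measurable_incMin hδ k 0)

theorem IsLevy.isProbabilityMeasure_map (hX : IsLevy P ℱ X) {t : ℝ} (ht : 0 ≤ t) :
    IsProbabilityMeasure (P.map (X t)) :=
  have := hX.isProb
  Measure.isProbabilityMeasure_map (hX.measurable ht).aemeasurable

/-- Simple Markov property: the minimum of the future grid increments is independent of the past
and has the law of the minimum of a random walk. -/
theorem IsLevy.map_prodMk_incMin (hX : IsLevy P ℱ X) {δ : ℝ} (hδ : 0 < δ) (k : ℕ) :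
    ∀ (j : ℕ) (E : Type) [MeasurableSpace E] (Z : Ω → E),
      Measurable[ℱ ((j : ℝ) * δ)] Z →
      P.map (fun ω => (Z ω, incMin X δ k j ω)) =
        (P.map Z).prod (walkMinLaw (P.map (X δ)) k) := by
  have := hX.isProb
  have hρ := hX.isProbabilityMeasure_map hδ.le
  induction k with
  | zero =>
    intro j E _ Z hZ
    have hZ' : Measurable Z := hZ.mono (ℱ.le _) le_rfl
    simp only [incMin, walkMinLaw]
    rw [Measure.prod_dirac, Measure.map_map (by fun_prop) hZ']
    rfl
  | succ k ih =>
    intro j E _ Z hZ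
    have hZ' : Measurable Z := hZ.mono (ℱ.le _) le_rfl
    set ξ : Ω → ℝ := fun ω => X (((j + 1 : ℕ) : ℝ) * δ) ω - X ((j : ℝ) * δ) ω with hξ
    have hξm : Measurable[ℱ (((j + 1 : ℕ) : ℝ) * δ)] ξ :=
      Measurable.sub (hX.measurable_grid hδ le_rfl) (hX.measurable_grid hδ (Nat.le_succ j))
    have hξ' : Measurable ξ := hξm.mono (ℱ.le _) le_rfl
    have hle : (j : ℝ) * δ ≤ ((j + 1 : ℕ) : ℝ) * δ := by
      push_cast; nlinarith
    have hZm : Measurable[ℱ (((j + 1 : ℕ) : ℝ) * δ)] Z := hZ.mono (ℱ.mono hle) le_rfl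
    have hlaw : P.map ξ = P.map (X δ) := by
      have := hX.stationary ((j : ℝ) * δ) (((j + 1 : ℕ) : ℝ) * δ) (by positivity) hle
      rw [show ((j + 1 : ℕ) : ℝ) * δ - (j : ℝ) * δ = δ by push_cast; ring] at this
      exact this
    have hind : IndepFun Z ξ P := by
      rw [IndepFun_iff_Indep]
      exact (indep_of_indep_of_le_right
        (hX.indepIncrements ((j : ℝ) * δ) (((j + 1 : ℕ) : ℝ) * δ) (by positivity) hle)
        hZ.comap_le).symm
    have hpair : P.map (fun ω => (Z ω, ξ ω)) = (P.map Z).prod (P.map (X δ)) := by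
      rw [← hlaw]
      exact (indepFun_iff_map_prod_eq_prod_map_map hZ'.aemeasurable hξ'.aemeasurable).1 hind
    have hih := ih (j + 1) (E × ℝ) (fun ω => (Z ω, ξ ω)) (hZm.prodMk hξm)
    have hM := hX.measurable_incMin hδ k (j + 1)
    let g : (E × ℝ) × ℝ → E × ℝ := fun q => (q.1.1, min 0 (q.1.2 + q.2))
    have hg : Measurable g := by fun_prop
    have h1 : P.map (fun ω => (Z ω, incMin X δ (k + 1) j ω)) =
        (P.map (fun ω => ((Z ω, ξ ω), incMin X δ k (j + 1) ω))).map g := by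
      rw [Measure.map_map hg ((hZ'.prodMk hξ').prodMk hM)]
      rfl
    have hPZ : IsProbabilityMeasure (P.map Z) :=
      Measure.isProbabilityMeasure_map hZ'.aemeasurable
    rw [h1, hih, hpair]
    have h2 : (((P.map Z).prod (P.map (X δ))).prod (walkMinLaw (P.map (X δ)) k)) =
        ((P.map Z).prod ((P.map (X δ)).prod (walkMinLaw (P.map (X δ)) k))).map
          MeasurableEquiv.prodAssoc.symm := by
      rw [← Measure.prodAssoc_prod, Measure.map_map (by fun_prop) (by fun_prop)]
      simp
    rw [h2, Measure.map_map hg (by fun_prop)]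
    have h3 : (P.map Z).prod (walkMinLaw (P.map (X δ)) (k + 1)) =
        ((P.map Z).prod ((P.map (X δ)).prod (walkMinLaw (P.map (X δ)) k))).map
          (Prod.map id (fun q : ℝ × ℝ => min 0 (q.1 + q.2))) := by
      rw [← Measure.map_prod_map _ _ measurable_id (by fun_prop), Measure.map_id]
      rfl
    rw [h3]
    rfl

theorem IsLevy.setLIntegral_markov (hX : IsLevy P ℱ X) {δ : ℝ} (hδ : 0 < δ) (k j : ℕ)
    {B : Set Ω} (hB : MeasurableSet[ℱ ((j : ℝ) * δ)] B) {ψ : ℝ → ℝ≥0∞} (hψ : Measurable ψ) :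
    ∫⁻ ω in B, ∫⁻ y, ψ (X ((j : ℝ) * δ) ω + y) ∂(walkMinLaw (P.map (X δ)) k) ∂P =
      ∫⁻ ω in B, ψ (X ((j : ℝ) * δ) ω + incMin X δ k j ω) ∂P := by
  have := hX.isProb
  have hρ := hX.isProbabilityMeasure_map hδ.le
  have hB' : MeasurableSet B := ℱ.le _ _ hB
  have hXm := hX.measurable_grid hδ (le_refl j)
  have hI : Measurable[ℱ ((j : ℝ) * δ)] (B.indicator (fun _ => (1 : ℝ≥0∞))) :=
    Measurable.indicator (m := ℱ ((j : ℝ) * δ)) measurable_const hB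
  let Z : Ω → ℝ≥0∞ × ℝ := fun ω => (B.indicator (fun _ => 1) ω, X ((j : ℝ) * δ) ω)
  have hZ : Measurable[ℱ ((j : ℝ) * δ)] Z :=
    hI.prodMk hXm
  have hZ' : Measurable Z := hZ.mono (ℱ.le _) le_rfl
  have hlaw := hX.map_prodMk_incMin hδ k j (ℝ≥0∞ × ℝ) Z hZ
  have hPZ : IsProbabilityMeasure (P.map Z) :=
    Measure.isProbabilityMeasure_map hZ'.aemeasurable
  let G : (ℝ≥0∞ × ℝ) × ℝ → ℝ≥0∞ := fun q => q.1.1 * ψ (q.1.2 + q.2)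
  have hG : Measurable G := by fun_prop
  have h1 : ∫⁻ ω, G (Z ω, incMin X δ k j ω) ∂P =
      ∫⁻ ω, ∫⁻ y, G (Z ω, y) ∂(walkMinLaw (P.map (X δ)) k) ∂P := by
    rw [← lintegral_map (f := G) hG (hZ'.prodMk (hX.measurable_incMin hδ k j)), hlaw,
      lintegral_prod _ hG.aemeasurable, lintegral_map hG.lintegral_prod_right' hZ']
  rw [← lintegral_indicator hB', ← lintegral_indicator hB']
  have e1 : ∀ ω, B.indicator (fun ω => ψ (X ((j : ℝ) * δ) ω + incMin X δ k j ω)) ω =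
      G (Z ω, incMin X δ k j ω) := by
    intro ω
    by_cases h : ω ∈ B <;> simp [G, Z, h]
  have e2 : ∀ ω, B.indicator
      (fun ω => ∫⁻ y, ψ (X ((j : ℝ) * δ) ω + y) ∂(walkMinLaw (P.map (X δ)) k)) ω =
      ∫⁻ y, G (Z ω, y) ∂(walkMinLaw (P.map (X δ)) k) := by
    intro ω
    by_cases h : ω ∈ B <;> simp [G, Z, h]
  simp only [e1, e2, h1]

end Markov

/-! ### Laws on the half-line `(-∞, 0]` and the price function -/

/-- The exponential moment `∫ e^y ν(dy)`. -/
def expMean (ν : Measure ℝ) : ℝ := ∫ y, Real.exp y ∂ν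

/-- The function `x ↦ E[(K m - e^{x + I})^+] / m` with `I` of law `ν` and `m = E[e^I]`. -/
def priceFn (K : ℝ) (ν : Measure ℝ) (x : ℝ) : ℝ :=
  (∫ y, max (K * expMean ν - Real.exp (x + y)) 0 ∂ν) / expMean ν

theorem integral_exp_add (ν : Measure ℝ) (x : ℝ) :
    ∫ y, Real.exp (x + y) ∂ν = Real.exp x * expMean ν := by
  simp only [Real.exp_add, expMean, integral_const_mul]

section HalfLine

variable {ν : Measure ℝ} [IsProbabilityMeasure ν]

theorem integrable_exp_of_ae_nonpos (hν : ∀ᵐ y ∂ν, y ≤ 0) (x : ℝ) :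
    Integrable (fun y => Real.exp (x + y)) ν := by
  refine Integrable.of_bound (C := Real.exp x) (by fun_prop) ?_
  filter_upwards [hν] with y hy
  rw [Real.norm_eq_abs, abs_of_pos (Real.exp_pos _)]
  exact Real.exp_le_exp.2 (by linarith)

theorem expMean_pos (hν : ∀ᵐ y ∂ν, y ≤ 0) : 0 < expMean ν := by
  have := integrable_exp_of_ae_nonpos hν 0
  simp only [zero_add] at this
  exact integral_exp_pos this

theorem integrable_put (hν : ∀ᵐ y ∂ν, y ≤ 0) (c x : ℝ) :
    Integrable (fun y => max (c - Real.exp (x + y)) 0) ν :=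
  ((integrable_const c).sub (integrable_exp_of_ae_nonpos hν x)).pos_part

theorem integral_const_sub_exp (hν : ∀ᵐ y ∂ν, y ≤ 0) (c x : ℝ) :
    ∫ y, (c - Real.exp (x + y)) ∂ν = c - Real.exp x * expMean ν := by
  rw [integral_sub (integrable_const c) (integrable_exp_of_ae_nonpos hν x), integral_exp_add]
  simp

theorem lintegral_put (hν : ∀ᵐ y ∂ν, y ≤ 0) (c x : ℝ) :
    ∫⁻ y, ENNReal.ofReal (c - Real.exp (x + y)) ∂ν =
      ENNReal.ofReal (∫ y, max (c - Real.exp (x + y)) 0 ∂ν) := by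
  rw [ofReal_integral_eq_lintegral_ofReal (integrable_put hν c x)
    (Eventually.of_forall fun y => le_max_right _ _)]
  refine lintegral_congr fun y => ?_
  simp [ENNReal.ofReal_max]

theorem mul_payoff_le_lintegral (hν : ∀ᵐ y ∂ν, y ≤ 0) (K z : ℝ) :
    ENNReal.ofReal (expMean ν) * ENNReal.ofReal (K - Real.exp z) ≤
      ∫⁻ y, ENNReal.ofReal (K * expMean ν - Real.exp (z + y)) ∂ν := by
  rw [lintegral_put hν, ← ENNReal.ofReal_mul (expMean_pos hν).le]
  refine ENNReal.ofReal_le_ofReal ?_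
  calc expMean ν * (K - Real.exp z) = ∫ y, (K * expMean ν - Real.exp (z + y)) ∂ν := by
        rw [integral_const_sub_exp hν]; ring
    _ ≤ _ := integral_mono ((integrable_const _).sub (integrable_exp_of_ae_nonpos hν z))
        (integrable_put hν _ z) fun y => le_max_left _ _

theorem lintegral_le_mul_payoff (hν : ∀ᵐ y ∂ν, y ≤ 0) {K z : ℝ}
    (hz : Real.exp z ≤ K * expMean ν) :
    ∫⁻ y, ENNReal.ofReal (K * expMean ν - Real.exp (z + y)) ∂ν ≤
      ENNReal.ofReal (expMean ν) * ENNReal.ofReal (K - Real.exp z) := by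
  rw [lintegral_put hν, ← ENNReal.ofReal_mul (expMean_pos hν).le]
  refine ENNReal.ofReal_le_ofReal (le_of_eq ?_)
  calc ∫ y, max (K * expMean ν - Real.exp (z + y)) 0 ∂ν
      = ∫ y, (K * expMean ν - Real.exp (z + y)) ∂ν := by
        refine integral_congr_ae ?_
        filter_upwards [hν] with y hy
        refine max_eq_left (sub_nonneg.2 (le_trans (Real.exp_le_exp.2 ?_) hz))
        linarith
    _ = expMean ν * (K - Real.exp z) := by
        rw [integral_const_sub_exp hν]; ring

theorem ofReal_mul_priceFn (hν : ∀ᵐ y ∂ν, y ≤ 0) (K x : ℝ) :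
    ENNReal.ofReal (expMean ν * priceFn K ν x) =
      ∫⁻ y, ENNReal.ofReal (K * expMean ν - Real.exp (x + y)) ∂ν := by
  rw [lintegral_put hν, priceFn, mul_div_cancel₀ _ (expMean_pos hν).ne']

theorem priceFn_nonneg (hν : ∀ᵐ y ∂ν, y ≤ 0) (K x : ℝ) : 0 ≤ priceFn K ν x :=
  div_nonneg (integral_nonneg fun _ => le_max_right _ _) (expMean_pos hν).le

end HalfLine

/-! ### Optimal stopping on a grid -/

/-- Geometric weights `(1 - p) p^k`. -/
def geomWeight (p : ℝ) (k : ℕ) : ℝ≥0∞ := ENNReal.ofReal ((1 - p) * p ^ k)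

/-- The law of the minimum of a random walk with step law `ρ` up to an independent geometric
time. -/
def killedLaw (ρ : Measure ℝ) (p : ℝ) : Measure ℝ :=
  Measure.sum fun k => geomWeight p k • walkMinLaw ρ k

theorem lintegral_killedLaw (ρ : Measure ℝ) (p : ℝ) (ψ : ℝ → ℝ≥0∞) :
    ∫⁻ y, ψ y ∂(killedLaw ρ p) = ∑' k, geomWeight p k * ∫⁻ y, ψ y ∂(walkMinLaw ρ k) := by
  simp [killedLaw, lintegral_sum_measure]

theorem tsum_geomWeight {p : ℝ} (h0 : 0 ≤ p) (h1 : p < 1) : ∑' k, geomWeight p k = 1 := by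
  unfold geomWeight
  rw [← ENNReal.ofReal_tsum_of_nonneg
    (fun k => mul_nonneg (by linarith) (pow_nonneg h0 k))
    ((summable_geometric_of_lt_one h0 h1).mul_left _), tsum_mul_left,
    tsum_geometric_of_lt_one h0 h1, mul_inv_cancel₀ (by linarith), ENNReal.ofReal_one]

theorem isProbabilityMeasure_killedLaw (ρ : Measure ℝ) [IsProbabilityMeasure ρ] {p : ℝ}
    (h0 : 0 ≤ p) (h1 : p < 1) : IsProbabilityMeasure (killedLaw ρ p) := by
  constructor
  have := lintegral_killedLaw ρ p (fun _ => 1)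
  simpa [tsum_geomWeight h0 h1] using this

theorem killedLaw_ae_nonpos (ρ : Measure ℝ) [IsProbabilityMeasure ρ] (p : ℝ) :
    ∀ᵐ y ∂(killedLaw ρ p), y ≤ 0 := by
  rw [killedLaw, Measure.ae_sum_iff' measurableSet_Iic]
  exact fun k => Measure.ae_smul_measure (walkMinLaw_ae_nonpos ρ k) _

theorem ofReal_pow_mul_geomWeight {p : ℝ} (h0 : 0 ≤ p) (j k : ℕ) :
    ENNReal.ofReal (p ^ j) * geomWeight p k = geomWeight p (j + k) := by
  rw [geomWeight, geomWeight, ← ENNReal.ofReal_mul (pow_nonneg h0 j)]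
  congr 1
  ring

theorem tsum_add_eq_tsum_ite (a : ℕ → ℝ≥0∞) (j : ℕ) :
    ∑' k, a (j + k) = ∑' l, if j ≤ l then a l else 0 := by
  have h := ENNReal.summable.sum_add_tsum_nat_add' (k := j)
    (f := fun l => if j ≤ l then a l else 0)
  rw [← h, Finset.sum_eq_zero, zero_add]
  · exact tsum_congr fun k => by simp [add_comm]
  · intro i hi
    simp [Finset.mem_range.1 hi]

section Grid

variable [m0 : MeasurableSpace Ω] {P : Measure Ω} {ℱ : Filtration ℝ m0} {X : ℝ → Ω → ℝ}

theorem IsLevy.lintegral_walkMinLaw (hX : IsLevy P ℱ X) {δ : ℝ} (hδ : 0 < δ) (k : ℕ)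
    {ψ : ℝ → ℝ≥0∞} (hψ : Measurable ψ) :
    ∫⁻ y, ψ y ∂(walkMinLaw (P.map (X δ)) k) = ∫⁻ ω, ψ (gridInf X δ k ω) ∂P := by
  have := hX.isProb
  have h := hX.setLIntegral_markov hδ k 0 (B := univ) MeasurableSet.univ hψ
  simp only [Nat.cast_zero, zero_mul, setLIntegral_univ] at h
  unfold gridInf
  rw [← h]
  have h0 : ∀ᵐ ω ∂P, ∫⁻ y, ψ (X 0 ω + y) ∂(walkMinLaw (P.map (X δ)) k) =
      ∫⁻ y, ψ y ∂(walkMinLaw (P.map (X δ)) k) := by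
    filter_upwards [hX.zero] with ω hω
    simp [hω]
  rw [lintegral_congr_ae h0]
  simp

theorem IsLevy.tsum_setLIntegral_killedLaw (hX : IsLevy P ℱ X) {δ p : ℝ} (hδ : 0 < δ) (h0 : 0 ≤ p)
    {B : ℕ → Set Ω} (hB : ∀ j : ℕ, MeasurableSet[ℱ ((j : ℝ) * δ)] (B j))
    {ψ : ℝ → ℝ≥0∞} (hψ : Measurable ψ) :
    ∑' j : ℕ, ENNReal.ofReal (p ^ j) *
        ∫⁻ ω in B j, ∫⁻ y, ψ (X ((j : ℝ) * δ) ω + y) ∂(killedLaw (P.map (X δ)) p) ∂P =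
      ∑' l, geomWeight p l * ∫⁻ ω, ∑' j : ℕ, (if j ≤ l then
        (B j).indicator (fun ω => ψ (X ((j : ℝ) * δ) ω + incMin X δ (l - j) j ω)) ω else 0) ∂P := by
  have hρ := hX.isProbabilityMeasure_map hδ.le
  have hB' : ∀ j, MeasurableSet (B j) := fun j => ℱ.le _ _ (hB j)
  have hXm : ∀ j : ℕ, Measurable (X ((j : ℝ) * δ)) := fun j => hX.measurable (by positivity)
  let I : ℕ → ℕ → ℝ≥0∞ := fun j k =>
    ∫⁻ ω in B j, ψ (X ((j : ℝ) * δ) ω + incMin X δ k j ω) ∂P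
  have hm : ∀ k j : ℕ, Measurable fun ω => ψ (X ((j : ℝ) * δ) ω + incMin X δ k j ω) :=
    fun k j => hψ.comp ((hXm j).add (hX.measurable_incMin hδ k j))
  have hL : ∀ j : ℕ, ENNReal.ofReal (p ^ j) *
        ∫⁻ ω in B j, ∫⁻ y, ψ (X ((j : ℝ) * δ) ω + y) ∂(killedLaw (P.map (X δ)) p) ∂P =
      ∑' l, if j ≤ l then geomWeight p l * I j (l - j) else 0 := by
    intro j
    rw [← tsum_add_eq_tsum_ite (fun l => geomWeight p l * I j (l - j)) j]
    simp only [lintegral_killedLaw]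
    rw [lintegral_tsum]
    · rw [← ENNReal.tsum_mul_left]
      refine tsum_congr fun k => ?_
      rw [lintegral_const_mul, hX.setLIntegral_markov hδ k j (hB j) hψ, ← mul_assoc,
        ofReal_pow_mul_geomWeight h0]
      · simp [I]
      · have : Measurable fun q : Ω × ℝ => ψ (X ((j : ℝ) * δ) q.1 + q.2) :=
          hψ.comp (((hXm j).comp measurable_fst).add measurable_snd)
        exact this.lintegral_prod_right'
    · intro k
      have : Measurable fun q : Ω × ℝ => ψ (X ((j : ℝ) * δ) q.1 + q.2) :=
        hψ.comp (((hXm j).comp measurable_fst).add measurable_snd)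
      exact (this.lintegral_prod_right'.const_mul _).aemeasurable
  simp only [hL]
  rw [ENNReal.tsum_comm]
  refine tsum_congr fun l => ?_
  rw [lintegral_tsum, ← ENNReal.tsum_mul_left]
  · refine tsum_congr fun j => ?_
    split_ifs with hjl
    · rw [lintegral_indicator (hB' j)]
    · simp
  · intro j
    split_ifs with hjl
    · exact ((hm _ _).indicator (hB' j)).aemeasurable
    · exact aemeasurable_const

theorem IsLevy.tsum_setLIntegral_le (hX : IsLevy P ℱ X) {δ p : ℝ} (hδ : 0 < δ) (h0 : 0 ≤ p)
    {B : ℕ → Set Ω} (hB : ∀ j : ℕ, MeasurableSet[ℱ ((j : ℝ) * δ)] (B j))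
    (hdisj : Pairwise fun i j => Disjoint (B i) (B j))
    {ψ : ℝ → ℝ≥0∞} (hψ : Measurable ψ) (hanti : Antitone ψ) :
    ∑' j : ℕ, ENNReal.ofReal (p ^ j) *
        ∫⁻ ω in B j, ∫⁻ y, ψ (X ((j : ℝ) * δ) ω + y) ∂(killedLaw (P.map (X δ)) p) ∂P ≤
      ∫⁻ y, ψ y ∂(killedLaw (P.map (X δ)) p) := by
  rw [hX.tsum_setLIntegral_killedLaw hδ h0 hB hψ, lintegral_killedLaw]
  refine ENNReal.tsum_le_tsum fun l => mul_le_mul_right ?_ _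
  rw [hX.lintegral_walkMinLaw hδ l hψ]
  refine lintegral_mono fun ω => ?_
  by_cases h : ∃ j, ω ∈ B j
  · obtain ⟨j, hj⟩ := h
    rw [tsum_eq_single j]
    · split_ifs with hjl
      · rw [indicator_of_mem hj]
        refine hanti ?_
        simpa [Nat.add_sub_cancel' hjl] using gridInf_le_add_incMin X δ ω j (l - j)
      · exact zero_le
    · intro i hij
      have : ω ∉ B i := fun hi => (hdisj hij).le_bot ⟨hi, hj⟩
      simp [this]
  · push Not at h
    simp [h]

theorem IsLevy.le_tsum_setLIntegral (hX : IsLevy P ℱ X) {δ p c : ℝ} (hδ : 0 < δ) (h0 : 0 ≤ p)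
    {B : ℕ → Set Ω} (hB : ∀ j : ℕ, MeasurableSet[ℱ ((j : ℝ) * δ)] (B j))
    (hBdef : ∀ (j : ℕ) ω, X ((j : ℝ) * δ) ω < c → (∀ i : ℕ, i < j → c ≤ X ((i : ℝ) * δ) ω) → ω ∈ B j)
    {ψ : ℝ → ℝ≥0∞} (hψ : Measurable ψ) (hanti : Antitone ψ) (hzero : ∀ z, c ≤ z → ψ z = 0) :
    ∫⁻ y, ψ y ∂(killedLaw (P.map (X δ)) p) ≤ ∑' j : ℕ, ENNReal.ofReal (p ^ j) *
        ∫⁻ ω in B j, ∫⁻ y, ψ (X ((j : ℝ) * δ) ω + y) ∂(killedLaw (P.map (X δ)) p) ∂P := by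
  rw [hX.tsum_setLIntegral_killedLaw hδ h0 hB hψ, lintegral_killedLaw]
  refine ENNReal.tsum_le_tsum fun l => mul_le_mul_right ?_ _
  rw [hX.lintegral_walkMinLaw hδ l hψ]
  refine lintegral_mono fun ω => ?_
  by_cases h : c ≤ gridInf X δ l ω
  · rw [hzero _ h]; exact zero_le
  · have h' : ∃ i, i ≤ l ∧ X ((i : ℝ) * δ) ω < c := by
      rw [le_gridInf_iff] at h
      push Not at h
      exact h
    have hj := Nat.find_spec h'
    have hmin : ∀ i : ℕ, i < Nat.find h' → c ≤ X ((i : ℝ) * δ) ω := by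
      intro i hi
      have := Nat.find_min h' hi
      push Not at this
      exact this (hi.le.trans hj.1)
    set j := Nat.find h'
    refine le_trans ?_ (ENNReal.le_tsum j)
    rw [if_pos hj.1, indicator_of_mem (hBdef j ω hj.2 hmin)]
    refine hanti ?_
    have := add_incMin_le_gridInf X δ ω j (l - j) fun i hi => (hj.2.le).trans (hmin i hi)
    simpa [Nat.add_sub_cancel' hj.1] using this

end Grid

section GridPayoff

theorem putPayoff_nonneg (X : ℝ → Ω → ℝ) (r K x : ℝ) (τ : Ω → ℝ≥0∞) (ω : Ω) :
    0 ≤ putPayoff X r K x τ ω := by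
  unfold putPayoff stopPayoff
  split_ifs
  · positivity
  · exact le_rfl

theorem putPayoff_le (X : ℝ → Ω → ℝ) {r K : ℝ} (hr : 0 ≤ r) (hK : 0 ≤ K) (x : ℝ) (τ : Ω → ℝ≥0∞)
    (ω : Ω) : putPayoff X r K x τ ω ≤ K := by
  unfold putPayoff stopPayoff
  split_ifs
  · have h1 : Real.exp (-(r * (τ ω).toReal)) ≤ 1 :=
      Real.exp_le_one_iff.2 (by have : 0 ≤ r * (τ ω).toReal := by positivity
                                linarith)
    have h2 : max (K - Real.exp (x + X (τ ω).toReal ω)) 0 ≤ K :=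
      max_le (by linarith [Real.exp_pos (x + X (τ ω).toReal ω)]) hK
    calc _ ≤ 1 * K := mul_le_mul h1 h2 (le_max_right _ _) zero_le_one
      _ = K := one_mul K
  · exact hK

theorem ofReal_putPayoff_grid (X : ℝ → Ω → ℝ) (r K x : ℝ) {δ : ℝ} (hδ : 0 < δ) (τ : Ω → ℝ≥0∞)
    (ω : Ω) (hτ : τ ω = ∞ ∨ ∃ j : ℕ, τ ω = ENNReal.ofReal ((j : ℝ) * δ)) :
    ENNReal.ofReal (putPayoff X r K x τ ω) =
      ∑' j : ℕ, {ω | τ ω = ENNReal.ofReal ((j : ℝ) * δ)}.indicator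
        (fun ω => ENNReal.ofReal (Real.exp (-(r * δ)) ^ j) *
          ENNReal.ofReal (K - Real.exp (x + X ((j : ℝ) * δ) ω))) ω := by
  rcases hτ with h | ⟨j, h⟩
  · have h0 : ∀ j : ℕ, ω ∉ {ω | τ ω = ENNReal.ofReal ((j : ℝ) * δ)} := fun j hj =>
      ENNReal.ofReal_ne_top (hj.symm.trans h)
    simp only [indicator_of_notMem (h0 _), tsum_zero]
    simp [putPayoff, stopPayoff, h]
  · rw [tsum_eq_single j]
    · have hnn : 0 ≤ (j : ℝ) * δ := by positivity
      rw [indicator_of_mem (by exact h)]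
      simp only [putPayoff, stopPayoff, h, ENNReal.toReal_ofReal hnn]
      rw [if_pos ENNReal.ofReal_ne_top, ENNReal.ofReal_mul (Real.exp_pos _).le,
        ENNReal.ofReal_max, ENNReal.ofReal_zero, max_eq_left zero_le, ← Real.exp_nat_mul]
      congr 3
      ring
    · intro i hij
      refine indicator_of_notMem (fun hi => hij ?_) _
      rw [mem_ofPred_eq, h, ENNReal.ofReal_eq_ofReal_iff (by positivity) (by positivity)] at hi
      exact_mod_cast (mul_right_cancel₀ hδ.ne' hi).symm

variable [m0 : MeasurableSpace Ω] {P : Measure Ω} {ℱ : Filtration ℝ m0} {X : ℝ → Ω → ℝ}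

theorem IsLevy.measurable_putPayoff_grid (hX : IsLevy P ℱ X) (r K x : ℝ) {δ : ℝ} (hδ : 0 < δ)
    {τ : Ω → ℝ≥0∞} (hτ : ∀ ω, τ ω = ∞ ∨ ∃ j : ℕ, τ ω = ENNReal.ofReal ((j : ℝ) * δ))
    (hm : ∀ j : ℕ, MeasurableSet[ℱ ((j : ℝ) * δ)] {ω | τ ω = ENNReal.ofReal ((j : ℝ) * δ)}) :
    Measurable (putPayoff X r K x τ) := by
  have h : putPayoff X r K x τ = fun ω => (∑' j : ℕ,
      {ω | τ ω = ENNReal.ofReal ((j : ℝ) * δ)}.indicator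
        (fun ω => ENNReal.ofReal (Real.exp (-(r * δ)) ^ j) *
          ENNReal.ofReal (K - Real.exp (x + X ((j : ℝ) * δ) ω))) ω).toReal := by
    funext ω
    rw [← ofReal_putPayoff_grid X r K x hδ τ ω (hτ ω),
      ENNReal.toReal_ofReal (putPayoff_nonneg X r K x τ ω)]
  rw [h]
  refine (Measurable.tsum fun j => Measurable.indicator ?_ (ℱ.le _ _ (hm j))).ennreal_toReal
  have := hX.measurable (t := (j : ℝ) * δ) (by positivity)
  fun_prop

theorem IsLevy.lintegral_putPayoff_grid (hX : IsLevy P ℱ X) (r K x : ℝ) {δ : ℝ} (hδ : 0 < δ)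
    {τ : Ω → ℝ≥0∞} (hτ : ∀ ω, τ ω = ∞ ∨ ∃ j : ℕ, τ ω = ENNReal.ofReal ((j : ℝ) * δ))
    (hm : ∀ j : ℕ, MeasurableSet[ℱ ((j : ℝ) * δ)] {ω | τ ω = ENNReal.ofReal ((j : ℝ) * δ)}) :
    ∫⁻ ω, ENNReal.ofReal (putPayoff X r K x τ ω) ∂P =
      ∑' j : ℕ, ENNReal.ofReal (Real.exp (-(r * δ)) ^ j) *
        ∫⁻ ω in {ω | τ ω = ENNReal.ofReal ((j : ℝ) * δ)},
          ENNReal.ofReal (K - Real.exp (x + X ((j : ℝ) * δ) ω)) ∂P := by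
  have hXm : ∀ j : ℕ, Measurable (X ((j : ℝ) * δ)) := fun j => hX.measurable (by positivity)
  have hg : ∀ j : ℕ, Measurable fun ω => ENNReal.ofReal (K - Real.exp (x + X ((j : ℝ) * δ) ω)) :=
    fun j => by have := hXm j; fun_prop
  simp only [ofReal_putPayoff_grid X r K x hδ τ _ (hτ _)]
  rw [lintegral_tsum
    fun j => (((hg j).const_mul _).indicator (ℱ.le _ _ (hm j))).aemeasurable]
  refine tsum_congr fun j => ?_
  rw [lintegral_indicator (ℱ.le _ _ (hm j)), lintegral_const_mul _ (hg j)]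

theorem integrable_of_bounds [IsFiniteMeasure P] {f : Ω → ℝ} {K : ℝ} (hm : AEStronglyMeasurable f P)
    (h0 : ∀ ω, 0 ≤ f ω) (h1 : ∀ ω, f ω ≤ K) : Integrable f P :=
  Integrable.of_bound hm K (Eventually.of_forall fun ω => by
    rw [Real.norm_eq_abs, abs_of_nonneg (h0 ω)]; exact h1 ω)

theorem antitone_ofReal_sub_exp (c x : ℝ) :
    Antitone fun z => ENNReal.ofReal (c - Real.exp (x + z)) := fun a b hab =>
  ENNReal.ofReal_le_ofReal (sub_le_sub_left (Real.exp_le_exp.2 (by linarith)) _)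

theorem exp_neg_mul_lt_one {r δ : ℝ} (hr : 0 < r) (hδ : 0 < δ) : Real.exp (-(r * δ)) < 1 :=
  Real.exp_lt_one_iff.2 (neg_lt_zero.2 (mul_pos hr hδ))

theorem IsLevy.integral_putPayoff_grid_le (hX : IsLevy P ℱ X) {r K : ℝ} (hr : 0 < r) (hK : 0 < K)
    (x : ℝ) {δ : ℝ} (hδ : 0 < δ)
    {τ : Ω → ℝ≥0∞} (hτ : ∀ ω, τ ω = ∞ ∨ ∃ j : ℕ, τ ω = ENNReal.ofReal ((j : ℝ) * δ))
    (hm : ∀ j : ℕ, MeasurableSet[ℱ ((j : ℝ) * δ)] {ω | τ ω = ENNReal.ofReal ((j : ℝ) * δ)}) :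
    ∫ ω, putPayoff X r K x τ ω ∂P ≤
      priceFn K (killedLaw (P.map (X δ)) (Real.exp (-(r * δ)))) x := by
  have := hX.isProb
  have hρ := hX.isProbabilityMeasure_map hδ.le
  have hp0 : 0 ≤ Real.exp (-(r * δ)) := (Real.exp_pos _).le
  have hp1 := exp_neg_mul_lt_one hr hδ
  set ν := killedLaw (P.map (X δ)) (Real.exp (-(r * δ))) with hν
  have hνp : IsProbabilityMeasure ν := isProbabilityMeasure_killedLaw _ hp0 hp1
  have hν0 : ∀ᵐ y ∂ν, y ≤ 0 := killedLaw_ae_nonpos _ _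
  have hmpos := expMean_pos hν0
  have hint : Integrable (putPayoff X r K x τ) P := integrable_of_bounds
    (hX.measurable_putPayoff_grid r K x hδ hτ hm).aestronglyMeasurable
    (putPayoff_nonneg X r K x τ) (putPayoff_le X hr.le hK.le x τ)
  rw [← mul_le_mul_iff_right₀ hmpos,
    ← ENNReal.ofReal_le_ofReal_iff (mul_nonneg hmpos.le (priceFn_nonneg hν0 K x)),
    ofReal_mul_priceFn hν0, ENNReal.ofReal_mul hmpos.le,
    ofReal_integral_eq_lintegral_ofReal hint (Eventually.of_forall (putPayoff_nonneg X r K x τ)),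
    hX.lintegral_putPayoff_grid r K x hδ hτ hm, ← ENNReal.tsum_mul_left]
  refine le_trans (ENNReal.tsum_le_tsum fun j => ?_)
    (hX.tsum_setLIntegral_le hδ hp0 hm ?_ (by fun_prop) (antitone_ofReal_sub_exp _ x))
  · rw [mul_left_comm]
    refine mul_le_mul_right ?_ _
    have hXm : Measurable (X ((j : ℝ) * δ)) := hX.measurable (by positivity)
    rw [← lintegral_const_mul _ (by fun_prop)]
    refine lintegral_mono fun ω => ?_
    simpa only [add_assoc] using mul_payoff_le_lintegral hν0 K (x + X ((j : ℝ) * δ) ω)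
  · intro i j hij
    refine disjoint_left.2 fun ω hi hj => hij ?_
    rw [mem_ofPred_eq] at hi hj
    rw [hi, ENNReal.ofReal_eq_ofReal_iff (by positivity) (by positivity)] at hj
    exact_mod_cast mul_right_cancel₀ hδ.ne' hj

theorem IsLevy.exists_priceFn_le (hX : IsLevy P ℱ X) {r K : ℝ} (hr : 0 < r) (hK : 0 < K)
    (x : ℝ) {δ : ℝ} (hδ : 0 < δ) :
    ∃ τ : Ω → ℝ≥0∞, IsStopTime ℱ τ ∧
      priceFn K (killedLaw (P.map (X δ)) (Real.exp (-(r * δ)))) x ≤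
        ∫ ω, putPayoff X r K x τ ω ∂P := by
  have := hX.isProb
  have hρ := hX.isProbabilityMeasure_map hδ.le
  have hp0 : 0 ≤ Real.exp (-(r * δ)) := (Real.exp_pos _).le
  have hp1 := exp_neg_mul_lt_one hr hδ
  set ν := killedLaw (P.map (X δ)) (Real.exp (-(r * δ))) with hν
  have hνp : IsProbabilityMeasure ν := isProbabilityMeasure_killedLaw _ hp0 hp1
  have hν0 : ∀ᵐ y ∂ν, y ≤ 0 := killedLaw_ae_nonpos _ _
  have hmpos := expMean_pos hν0
  have hKm : 0 < K * expMean ν := mul_pos hK hmpos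
  let c : ℝ := Real.log (K * expMean ν) - x
  let A : ℕ → Set Ω := fun j =>
    {ω | X ((j : ℝ) * δ) ω < c ∧ ∀ i < j, c ≤ X ((i : ℝ) * δ) ω}
  have hAm : ∀ j : ℕ, MeasurableSet[ℱ ((j : ℝ) * δ)] (A j) := by
    intro j
    have : A j = {ω | X ((j : ℝ) * δ) ω < c} ∩ ⋂ i : ℕ, ⋂ _ : i < j,
        {ω | c ≤ X ((i : ℝ) * δ) ω} := by
      ext ω; simp [A]
    rw [this]
    refine MeasurableSet.inter (hX.measurable_grid hδ le_rfl measurableSet_Iio) ?_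
    exact MeasurableSet.iInter fun i => MeasurableSet.iInter fun hi =>
      hX.measurable_grid hδ hi.le measurableSet_Ici
  have hAuniq : ∀ i j ω, ω ∈ A i → ω ∈ A j → i = j := by
    intro i j ω hi hj
    rcases lt_trichotomy i j with h | h | h
    · exact absurd hi.1 (not_lt.2 (hj.2 i h))
    · exact h
    · exact absurd hj.1 (not_lt.2 (hi.2 j h))
  let τ : Ω → ℝ≥0∞ := fun ω =>
    if h : ∃ j, ω ∈ A j then ENNReal.ofReal ((h.choose : ℝ) * δ) else ∞
  have hτA : ∀ j ω, ω ∈ A j → τ ω = ENNReal.ofReal ((j : ℝ) * δ) := by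
    intro j ω hj
    have h : ∃ j, ω ∈ A j := ⟨j, hj⟩
    simp only [τ, dif_pos h]
    rw [hAuniq _ j ω h.choose_spec hj]
  have hτn : ∀ ω, (¬ ∃ j, ω ∈ A j) → τ ω = ∞ := fun ω h => dif_neg h
  have hset : ∀ j : ℕ, {ω | τ ω = ENNReal.ofReal ((j : ℝ) * δ)} = A j := by
    intro j
    ext ω
    refine ⟨fun h => ?_, hτA j ω⟩
    by_cases hex : ∃ i, ω ∈ A i
    · obtain ⟨i, hi⟩ := hex
      rw [mem_ofPred_eq, hτA i ω hi,
        ENNReal.ofReal_eq_ofReal_iff (by positivity) (by positivity)] at h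
      have : i = j := by exact_mod_cast mul_right_cancel₀ hδ.ne' h
      exact this ▸ hi
    · rw [mem_ofPred_eq, hτn ω hex] at h
      exact absurd h.symm ENNReal.ofReal_ne_top
  have hgrid : ∀ ω, τ ω = ∞ ∨ ∃ j : ℕ, τ ω = ENNReal.ofReal ((j : ℝ) * δ) := by
    intro ω
    by_cases hex : ∃ i, ω ∈ A i
    · exact Or.inr ⟨hex.choose, hτA _ ω hex.choose_spec⟩
    · exact Or.inl (hτn ω hex)
  have hm : ∀ j : ℕ, MeasurableSet[ℱ ((j : ℝ) * δ)] {ω | τ ω = ENNReal.ofReal ((j : ℝ) * δ)} :=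
    fun j => by rw [hset]; exact hAm j
  refine ⟨τ, ?_, ?_⟩
  · intro t ht
    have : {ω | τ ω ≤ ENNReal.ofReal t} = ⋃ j : ℕ, ⋃ _ : (j : ℝ) * δ ≤ t, A j := by
      ext ω
      simp only [mem_ofPred_eq, mem_iUnion, exists_prop]
      constructor
      · intro h
        rcases hgrid ω with h' | ⟨j, h'⟩
        · rw [h', top_le_iff] at h
          exact absurd h ENNReal.ofReal_ne_top
        · refine ⟨j, ?_, by rw [← hset]; exact h'⟩
          rwa [h', ENNReal.ofReal_le_ofReal_iff ht] at h
      · rintro ⟨j, hj, hA⟩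
        rw [hτA j ω hA]
        exact ENNReal.ofReal_le_ofReal hj
    rw [this]
    exact MeasurableSet.iUnion fun j => MeasurableSet.iUnion fun hj => ℱ.mono hj _ (hAm j)
  have hint : Integrable (putPayoff X r K x τ) P := integrable_of_bounds
    (hX.measurable_putPayoff_grid r K x hδ hgrid hm).aestronglyMeasurable
    (putPayoff_nonneg X r K x τ) (putPayoff_le X hr.le hK.le x τ)
  rw [← mul_le_mul_iff_right₀ hmpos, ← ENNReal.ofReal_le_ofReal_iff
      (mul_nonneg hmpos.le (integral_nonneg (putPayoff_nonneg X r K x τ))),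
    ofReal_mul_priceFn hν0, ENNReal.ofReal_mul hmpos.le,
    ofReal_integral_eq_lintegral_ofReal hint (Eventually.of_forall (putPayoff_nonneg X r K x τ)),
    hX.lintegral_putPayoff_grid r K x hδ hgrid hm, ← ENNReal.tsum_mul_left]
  refine le_trans (hX.le_tsum_setLIntegral (c := c) hδ hp0 hm
    (fun j ω h1 h2 => hτA j ω ⟨h1, h2⟩) (by fun_prop) (antitone_ofReal_sub_exp _ x) ?_)
    (ENNReal.tsum_le_tsum fun j => ?_)
  · intro z hz
    refine ENNReal.ofReal_of_nonpos (sub_nonpos.2 ?_)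
    rw [← Real.log_le_iff_le_exp hKm]
    simp only [c] at hz
    linarith
  · rw [mul_left_comm]
    refine mul_le_mul_right ?_ _
    have hXm : Measurable (X ((j : ℝ) * δ)) := hX.measurable (by positivity)
    rw [← lintegral_const_mul _ (by fun_prop)]
    refine setLIntegral_mono' (ℱ.le _ _ (hm j)) fun ω hω => ?_
    rw [hset] at hω
    have hz : Real.exp (x + X ((j : ℝ) * δ) ω) ≤ K * expMean ν := by
      rw [← Real.le_log_iff_exp_le hKm]
      have := hω.1
      simp only [c] at this
      linarith
    simpa only [add_assoc] using lintegral_le_mul_payoff hν0 hz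

end GridPayoff

/-! ### The infimum up to an exponential time -/

theorem le_runInf (X : ℝ → Ω → ℝ) (ω : Ω) {t c : ℝ} (ht : 0 ≤ t)
    (h : ∀ s, 0 ≤ s → s ≤ t → c ≤ X s ω) : c ≤ runInf X t ω := by
  refine le_csInf ⟨_, 0, ⟨le_rfl, ht⟩, rfl⟩ ?_
  rintro _ ⟨s, hs, rfl⟩
  exact h s hs.1 hs.2

theorem exists_lt_of_runInf_lt (X : ℝ → Ω → ℝ) (ω : Ω) {t c : ℝ} (ht : 0 ≤ t)
    (h : runInf X t ω < c) : ∃ s, 0 ≤ s ∧ s ≤ t ∧ X s ω < c := by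
  obtain ⟨_, ⟨s, hs, rfl⟩, hlt⟩ := exists_lt_of_csInf_lt
    (⟨_, 0, ⟨le_rfl, ht⟩, rfl⟩ : ((fun s => X s ω) '' Set.Icc 0 t).Nonempty) h
  exact ⟨s, hs.1, hs.2, hlt⟩

section Paths

variable [m0 : MeasurableSpace Ω] {P : Measure Ω} {ℱ : Filtration ℝ m0} {X : ℝ → Ω → ℝ}

theorem IsLevy.bddBelow_image_Icc (hX : IsLevy P ℱ X) (ω : Ω) (t : ℝ) :
    BddBelow ((fun s => X s ω) '' Set.Icc 0 t) := by
  refine isCompact_Icc.induction_on (p := fun A => BddBelow ((fun s => X s ω) '' A)) (by simp)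
    (fun A B hAB hB => hB.mono (image_mono hAB))
    (fun A B hA hB => by simpa only [image_union] using hA.union hB) ?_
  intro s hs
  have hright : ∃ U ∈ nhdsWithin s (Set.Ici s), BddBelow ((fun u => X u ω) '' U) := by
    refine ⟨_, (hX.rightCont ω s hs.1).eventually (lt_mem_nhds (sub_one_lt (X s ω))),
      X s ω - 1, ?_⟩
    rintro _ ⟨u, hu, rfl⟩
    exact le_of_lt hu
  obtain ⟨U, hU, hUb⟩ := hright
  rcases hs.1.eq_or_lt with h0 | h0
  · subst h0
    exact ⟨U, nhdsWithin_mono _ (fun u hu => hu.1) hU, hUb⟩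
  · obtain ⟨l, hl⟩ := hX.leftLim ω s h0
    have hV := hl.eventually (lt_mem_nhds (sub_one_lt l))
    refine ⟨U ∪ {u | l - 1 < X u ω}, mem_nhdsWithin_of_mem_nhds ?_, ?_⟩
    · rw [← nhdsLT_sup_nhdsGE]
      exact ⟨mem_of_superset hV subset_union_right, mem_of_superset hU subset_union_left⟩
    · rw [image_union]
      refine hUb.union ⟨l - 1, ?_⟩
      rintro _ ⟨u, hu, rfl⟩
      exact le_of_lt hu

theorem IsLevy.runInf_le (hX : IsLevy P ℱ X) (ω : Ω) {s t : ℝ} (h0 : 0 ≤ s) (hst : s ≤ t) :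
    runInf X t ω ≤ X s ω :=
  csInf_le (hX.bddBelow_image_Icc ω t) ⟨s, ⟨h0, hst⟩, rfl⟩

theorem IsLevy.exists_forall_Ico (hX : IsLevy P ℱ X) (ω : Ω) {s : ℝ} (hs : 0 ≤ s) {U : Set ℝ}
    (hU : U ∈ nhds (X s ω)) : ∃ η > 0, ∀ u, s ≤ u → u < s + η → X u ω ∈ U := by
  have := (hX.rightCont ω s hs).eventually hU
  obtain ⟨v, hv, hsub⟩ := (mem_nhdsGE_iff_exists_Ico_subset).1 this
  refine ⟨v - s, sub_pos.2 hv, fun u hu hu' => hsub ⟨hu, by linarith⟩⟩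

theorem IsLevy.tendsto_gridInf (hX : IsLevy P ℱ X) (ω : Ω) {t : ℝ} (ht : 0 ≤ t) {δ : ℕ → ℝ}
    (hδ : ∀ n, 0 < δ n) (hδ0 : Tendsto δ atTop (nhds 0)) :
    Tendsto (fun n => gridInf X (δ n) (⌊t / δ n⌋₊ + 1) ω) atTop (nhds (runInf X t ω)) := by
  have hfl : ∀ n (s : ℝ), 0 ≤ s → s < ((⌊s / δ n⌋₊ + 1 : ℕ) : ℝ) * δ n ∧
      ((⌊s / δ n⌋₊ + 1 : ℕ) : ℝ) * δ n ≤ s + δ n := by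
    intro n s hs
    have h1 := Nat.lt_floor_add_one (s / δ n)
    have h2 := Nat.floor_le (div_nonneg hs (hδ n).le)
    rw [div_lt_iff₀ (hδ n)] at h1
    rw [le_div_iff₀ (hδ n)] at h2
    push_cast
    exact ⟨h1, by linarith⟩
  rw [tendsto_order]
  constructor
  · intro c hc
    obtain ⟨c', hcc', hc'⟩ := exists_between hc
    obtain ⟨η, hη, hη'⟩ := hX.exists_forall_Ico ω ht
      (lt_mem_nhds (hc'.trans_le (hX.runInf_le ω ht le_rfl)))
    filter_upwards [hδ0.eventually (gt_mem_nhds hη)] with n hn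
    refine hcc'.trans_le ((le_gridInf_iff _ _ _ _ _).2 fun i hi => ?_)
    have hi0 : 0 ≤ (i : ℝ) * δ n := by have := hδ n; positivity
    rcases le_total ((i : ℝ) * δ n) t with h | h
    · exact hc'.le.trans (hX.runInf_le ω hi0 h)
    · refine le_of_lt (hη' _ h ?_)
      have : (i : ℝ) * δ n ≤ ((⌊t / δ n⌋₊ + 1 : ℕ) : ℝ) * δ n :=
        mul_le_mul_of_nonneg_right (by exact_mod_cast hi) (hδ n).le
      linarith [(hfl n t ht).2]
  · intro c hc
    obtain ⟨s, hs0, hst, hs⟩ := exists_lt_of_runInf_lt X ω ht hc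
    obtain ⟨η, hη, hη'⟩ := hX.exists_forall_Ico ω hs0 (gt_mem_nhds hs)
    filter_upwards [hδ0.eventually (gt_mem_nhds hη)] with n hn
    refine lt_of_le_of_lt ((le_gridInf_iff _ _ _ _ _).1 le_rfl (⌊s / δ n⌋₊ + 1) ?_)
      (hη' (((⌊s / δ n⌋₊ + 1 : ℕ) : ℝ) * δ n) (hfl n s hs0).1.le
        (by linarith [(hfl n s hs0).2]))
    have := hδ n
    gcongr

theorem tendsto_one_div_nat : Tendsto (fun n : ℕ => 1 / ((n : ℝ) + 1)) atTop (nhds 0) :=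
  tendsto_one_div_add_atTop_nhds_zero_nat

theorem IsLevy.measurable_runInf (hX : IsLevy P ℱ X) {t : ℝ} (ht : 0 ≤ t) :
    Measurable (runInf X t) :=
  measurable_of_tendsto_metrizable
    (f := fun (n : ℕ) => gridInf X (1 / ((n : ℝ) + 1)) (⌊t / (1 / ((n : ℝ) + 1))⌋₊ + 1))
    (fun n => hX.measurable_gridInf (by positivity) _)
    (tendsto_pi_nhds.2 fun ω => hX.tendsto_gridInf ω ht (fun n => by positivity)
      tendsto_one_div_nat)

theorem IsLevy.runInf_nonpos (hX : IsLevy P ℱ X) :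
    ∀ᵐ ω ∂P, ∀ t, 0 ≤ t → runInf X t ω ≤ 0 := by
  filter_upwards [hX.zero] with ω hω t ht
  exact hω ▸ hX.runInf_le ω le_rfl ht

end Paths

/-- The standard exponential law. -/
def expLaw : Measure ℝ :=
  (volume.restrict (Set.Ioi 0)).withDensity fun t => ENNReal.ofReal (Real.exp (-t))

theorem integral_expLaw (f : ℝ → ℝ) :
    ∫ t, f t ∂expLaw = ∫ t in Set.Ioi 0, Real.exp (-t) * f t := by
  rw [expLaw, integral_withDensity_eq_integral_toReal_smul (by fun_prop)
    (Eventually.of_forall fun _ => ENNReal.ofReal_lt_top)]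
  simp [ENNReal.toReal_ofReal (Real.exp_pos _).le]

instance expLaw_isProbabilityMeasure : IsProbabilityMeasure expLaw := by
  constructor
  rw [expLaw, withDensity_apply _ MeasurableSet.univ, Measure.restrict_univ,
    ← ofReal_integral_eq_lintegral_ofReal (integrableOn_exp_neg_Ioi 0)
      (Eventually.of_forall fun _ => (Real.exp_pos _).le), integral_exp_neg_Ioi_zero,
    ENNReal.ofReal_one]

theorem expLaw_ae_pos : ∀ᵐ t ∂expLaw, 0 < t :=
  (withDensity_absolutelyContinuous _ _).ae_le (ae_restrict_mem measurableSet_Ioi)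

theorem expLaw_floor_eq {a : ℝ} (ha : 0 < a) (k : ℕ) :
    expLaw.map (fun t => ⌊t / a⌋₊) {k} = geomWeight (Real.exp (-a)) k := by
  have hmeas : Measurable fun t : ℝ => ⌊t / a⌋₊ := Nat.measurable_floor.comp (by fun_prop)
  rw [Measure.map_apply hmeas (measurableSet_singleton k)]
  have hset : (fun t : ℝ => ⌊t / a⌋₊) ⁻¹' {k} =ᵐ[expLaw] Set.Ioc (k * a) ((k + 1) * a) := by
    have hne : ∀ᵐ t ∂expLaw, t ≠ k * a ∧ t ≠ (k + 1) * a := by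
      refine (withDensity_absolutelyContinuous _ _).ae_le (ae_restrict_of_ae ?_)
      exact (Measure.ae_ne volume _).and (Measure.ae_ne volume _)
    filter_upwards [expLaw_ae_pos, hne] with t ht hn
    refine propext ?_
    change ⌊t / a⌋₊ = k ↔ t ∈ Set.Ioc (k * a) ((k + 1) * a)
    rw [Nat.floor_eq_iff (by positivity), le_div_iff₀ ha, div_lt_iff₀ ha]
    exact ⟨fun h => ⟨lt_of_le_of_ne h.1 hn.1.symm, h.2.le⟩,
      fun h => ⟨h.1.le, lt_of_le_of_ne h.2 hn.2⟩⟩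
  have hle : (k : ℝ) * a ≤ (k + 1) * a := by nlinarith
  rw [measure_congr hset, expLaw, withDensity_apply _ measurableSet_Ioc,
    Measure.restrict_restrict measurableSet_Ioc, inter_eq_left.2,
    ← ofReal_integral_eq_lintegral_ofReal
      ((Continuous.integrableOn_Icc (by fun_prop)).mono_set Ioc_subset_Icc_self)
      (Eventually.of_forall fun _ => (Real.exp_pos _).le),
    ← intervalIntegral.integral_of_le hle, geomWeight]
  · congr 1
    rw [intervalIntegral.integral_comp_neg (fun t => Real.exp t), integral_exp, sub_mul, one_mul,
      ← Real.exp_nat_mul, ← Real.exp_add]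
    congr 2 <;> ring
  · intro t ht
    exact lt_of_le_of_lt (by positivity) ht.1

/-! ### Convergence of price functions -/

theorem tendsto_expMean {ν : Measure ℝ} {νs : ℕ → Measure ℝ} (hν : ∀ᵐ y ∂ν, y ≤ 0)
    (hνs : ∀ n, ∀ᵐ y ∂(νs n), y ≤ 0)
    (hconv : ∀ (C : ℝ) (φ : ℝ → ℝ), Continuous φ → (∀ y, 0 ≤ φ y) → (∀ y, φ y ≤ C) →
      Tendsto (fun n => ∫ y, φ y ∂(νs n)) atTop (nhds (∫ y, φ y ∂ν))) :
    Tendsto (fun n => expMean (νs n)) atTop (nhds (expMean ν)) := by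
  have key : ∀ μ : Measure ℝ, (∀ᵐ y ∂μ, y ≤ 0) → expMean μ = ∫ y, Real.exp (min y 0) ∂μ := by
    intro μ hμ
    refine integral_congr_ae ?_
    filter_upwards [hμ] with y hy
    rw [min_eq_left hy]
  rw [key ν hν]
  simp only [fun n => key (νs n) (hνs n)]
  exact hconv 1 _ (by fun_prop) (fun y => (Real.exp_pos _).le)
    fun y => Real.exp_le_one_iff.2 (min_le_right _ _)

theorem tendsto_priceFn {ν : Measure ℝ} {νs : ℕ → Measure ℝ} [IsProbabilityMeasure ν]
    [∀ n, IsProbabilityMeasure (νs n)] (hν : ∀ᵐ y ∂ν, y ≤ 0) (hνs : ∀ n, ∀ᵐ y ∂(νs n), y ≤ 0)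
    (hconv : ∀ (C : ℝ) (φ : ℝ → ℝ), Continuous φ → (∀ y, 0 ≤ φ y) → (∀ y, φ y ≤ C) →
      Tendsto (fun n => ∫ y, φ y ∂(νs n)) atTop (nhds (∫ y, φ y ∂ν)))
    {K : ℝ} (hK : 0 ≤ K) (x : ℝ) :
    Tendsto (fun n => priceFn K (νs n) x) atTop (nhds (priceFn K ν x)) := by
  have hm := tendsto_expMean hν hνs hconv
  have hpos := expMean_pos hν
  refine Tendsto.div ?_ hm hpos.ne'
  set c := K * expMean ν with hc
  have hcpos : 0 ≤ c := mul_nonneg hK hpos.le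
  have h1 := hconv c (fun y => max (c - Real.exp (x + y)) 0) (by fun_prop)
    (fun y => le_max_right _ _)
    (fun y => max_le (by linarith [Real.exp_pos (x + y)]) hcpos)
  have h2 : Tendsto (fun n => (∫ y, max (K * expMean (νs n) - Real.exp (x + y)) 0 ∂(νs n)) -
      ∫ y, max (c - Real.exp (x + y)) 0 ∂(νs n)) atTop (nhds 0) := by
    have h0 : Tendsto (fun n => |K * expMean (νs n) - c|) atTop (nhds 0) := by
      have := ((hm.const_mul K).sub_const c).abs
      simpa [hc] using this
    refine squeeze_zero_norm (fun n => ?_) h0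
    rw [← integral_sub (integrable_put (hνs n) _ x) (integrable_put (hνs n) _ x)]
    have := norm_integral_le_of_norm_le_const (μ := νs n)
      (f := fun y => max (K * expMean (νs n) - Real.exp (x + y)) 0 - max (c - Real.exp (x + y)) 0)
      (C := |K * expMean (νs n) - c|) (Eventually.of_forall fun y => ?_)
    · simpa using this
    · rw [Real.norm_eq_abs]
      have := abs_max_sub_max_le_abs (K * expMean (νs n) - Real.exp (x + y))
        (c - Real.exp (x + y)) 0
      simpa using this
  simpa using h2.add h1

/-! ### The law of the infimum at an exponential time -/

/-- The law of the infimum of `X` up to an independent exponential time of rate `r`. -/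
def infLaw [MeasurableSpace Ω] (P : Measure Ω) (X : ℝ → Ω → ℝ) (r : ℝ) : Measure ℝ :=
  (expLaw.prod P).map fun q => runInf X (q.1 / r) q.2

section InfLaw

variable [m0 : MeasurableSpace Ω] {P : Measure Ω} {ℱ : Filtration ℝ m0} {X : ℝ → Ω → ℝ}

theorem IsLevy.ae_expLaw_prod_pos (hX : IsLevy P ℱ X) : ∀ᵐ q ∂(expLaw.prod P), 0 < q.1 := by
  have := hX.isProb
  exact Measure.quasiMeasurePreserving_fst.ae expLaw_ae_pos

theorem IsLevy.measurable_gridInf_floor (hX : IsLevy P ℱ X) {δ : ℝ} (hδ : 0 < δ) (a : ℝ) :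
    Measurable fun q : ℝ × Ω => gridInf X δ (⌊q.1 / a⌋₊ + 1) q.2 := by
  have h1 : Measurable fun q : ℕ × Ω => gridInf X δ (q.1 + 1) q.2 :=
    measurable_from_prod_countable_right fun k => hX.measurable_gridInf hδ (k + 1)
  have h2 : Measurable fun q : ℝ × Ω => (⌊q.1 / a⌋₊, q.2) :=
    (Nat.measurable_floor.comp (measurable_fst.div_const a)).prodMk measurable_snd
  exact h1.comp h2

theorem IsLevy.tendsto_gridInf_floor (hX : IsLevy P ℱ X) {r : ℝ} (hr : 0 < r) {δ : ℕ → ℝ}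
    (hδ : ∀ n, 0 < δ n) (hδ0 : Tendsto δ atTop (nhds 0)) :
    ∀ᵐ q ∂(expLaw.prod P), Tendsto (fun n => gridInf X (δ n) (⌊q.1 / (r * δ n)⌋₊ + 1) q.2) atTop
      (nhds (runInf X (q.1 / r) q.2)) := by
  filter_upwards [hX.ae_expLaw_prod_pos] with q hq
  simpa only [div_div] using hX.tendsto_gridInf q.2 (t := q.1 / r) (by positivity) hδ hδ0

theorem IsLevy.aemeasurable_runInf_prod (hX : IsLevy P ℱ X) {r : ℝ} (hr : 0 < r) :
    AEMeasurable (fun q : ℝ × Ω => runInf X (q.1 / r) q.2) (expLaw.prod P) :=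
  aemeasurable_of_tendsto_metrizable_ae atTop
    (fun n : ℕ => (hX.measurable_gridInf_floor (δ := 1 / ((n : ℝ) + 1)) (by positivity)
      (r * (1 / ((n : ℝ) + 1)))).aemeasurable)
    (hX.tendsto_gridInf_floor hr (fun n => by positivity) tendsto_one_div_nat)

theorem IsLevy.isProbabilityMeasure_infLaw (hX : IsLevy P ℱ X) {r : ℝ} (hr : 0 < r) :
    IsProbabilityMeasure (infLaw P X r) := by
  have := hX.isProb
  exact Measure.isProbabilityMeasure_map (hX.aemeasurable_runInf_prod hr)

theorem IsLevy.infLaw_ae_nonpos (hX : IsLevy P ℱ X) {r : ℝ} (hr : 0 < r) :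
    ∀ᵐ y ∂(infLaw P X r), y ≤ 0 := by
  have := hX.isProb
  rw [infLaw, ae_map_iff (hX.aemeasurable_runInf_prod hr) measurableSet_Iic]
  filter_upwards [hX.ae_expLaw_prod_pos,
    Measure.quasiMeasurePreserving_snd.ae hX.runInf_nonpos] with q h1 h2
  exact h2 _ (by positivity)

theorem IsLevy.lintegral_gridInf_floor (hX : IsLevy P ℱ X) {δ a : ℝ} (hδ : 0 < δ) (ha : 0 < a)
    {ψ : ℝ → ℝ≥0∞} (hψ : Measurable ψ) :
    ∫⁻ q, ψ (gridInf X δ (⌊q.1 / a⌋₊ + 1) q.2) ∂(expLaw.prod P) =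
      ∑' k, geomWeight (Real.exp (-a)) k * ∫⁻ y, ψ y ∂(walkMinLaw (P.map (X δ)) (k + 1)) := by
  have := hX.isProb
  have hm : Measurable fun q : ℝ × Ω => ψ (gridInf X δ (⌊q.1 / a⌋₊ + 1) q.2) :=
    hψ.comp (hX.measurable_gridInf_floor hδ a)
  rw [lintegral_prod _ hm.aemeasurable]
  have hfl : Measurable fun t : ℝ => ⌊t / a⌋₊ := Nat.measurable_floor.comp (by fun_prop)
  have h := lintegral_map (μ := expLaw)
    (f := fun k => ∫⁻ ω, ψ (gridInf X δ (k + 1) ω) ∂P) (measurable_of_countable _) hfl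
  rw [← h, lintegral_countable']
  refine tsum_congr fun k => ?_
  rw [expLaw_floor_eq ha, hX.lintegral_walkMinLaw hδ (k + 1) hψ, mul_comm]

theorem IsLevy.lintegral_killedLaw_eq (hX : IsLevy P ℱ X) {δ a : ℝ} (hδ : 0 < δ) (ha : 0 < a)
    {ψ : ℝ → ℝ≥0∞} (hψ : Measurable ψ) :
    ∫⁻ y, ψ y ∂(killedLaw (P.map (X δ)) (Real.exp (-a))) =
      ENNReal.ofReal (1 - Real.exp (-a)) * ∫⁻ y, ψ y ∂(walkMinLaw (P.map (X δ)) 0) +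
      ENNReal.ofReal (Real.exp (-a)) *
        ∫⁻ q, ψ (gridInf X δ (⌊q.1 / a⌋₊ + 1) q.2) ∂(expLaw.prod P) := by
  rw [lintegral_killedLaw, hX.lintegral_gridInf_floor hδ ha hψ, ← ENNReal.tsum_mul_left,
    tsum_eq_zero_add' ENNReal.summable]
  congr 1
  · simp [geomWeight]
  · refine tsum_congr fun k => ?_
    have h := ofReal_pow_mul_geomWeight (Real.exp_pos (-a)).le 1 k
    rw [pow_one, add_comm] at h
    rw [← mul_assoc, h]

theorem IsLevy.tendsto_integral_killedLaw (hX : IsLevy P ℱ X) {r : ℝ} (hr : 0 < r) {δ : ℕ → ℝ}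
    (hδ : ∀ n, 0 < δ n) (hδ0 : Tendsto δ atTop (nhds 0)) (C : ℝ) (φ : ℝ → ℝ) (hφ : Continuous φ)
    (h0 : ∀ y, 0 ≤ φ y) (hC : ∀ y, φ y ≤ C) :
    Tendsto (fun n => ∫ y, φ y ∂(killedLaw (P.map (X (δ n))) (Real.exp (-(r * δ n))))) atTop
      (nhds (∫ y, φ y ∂(infLaw P X r))) := by
  have := hX.isProb
  have hψ : Measurable fun y => ENNReal.ofReal (φ y) := hφ.measurable.ennreal_ofReal
  have hconv : ∀ μ : Measure ℝ, ∫ y, φ y ∂μ = (∫⁻ y, ENNReal.ofReal (φ y) ∂μ).toReal := fun μ =>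
    integral_eq_lintegral_of_nonneg_ae (Eventually.of_forall h0) hφ.aestronglyMeasurable
  have hle : ∀ μ : Measure ℝ, IsProbabilityMeasure μ →
      ∫⁻ y, ENNReal.ofReal (φ y) ∂μ ≤ ENNReal.ofReal C := fun μ hμ => by
    refine (lintegral_mono fun y => ENNReal.ofReal_le_ofReal (hC y)).trans ?_
    simp
  have hp := hX.isProbabilityMeasure_infLaw hr
  simp only [hconv]
  refine (ENNReal.tendsto_toReal ((hle _ hp).trans_lt ENNReal.ofReal_lt_top).ne).comp ?_
  have he : Tendsto (fun n => Real.exp (-(r * δ n))) atTop (nhds 1) := by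
    have : Tendsto (fun n => -(r * δ n)) atTop (nhds 0) := by simpa using (hδ0.const_mul r).neg
    simpa [Function.comp_def] using (Real.continuous_exp.tendsto 0).comp this
  have h1 : Tendsto (fun n => ENNReal.ofReal (1 - Real.exp (-(r * δ n))) *
      ∫⁻ y, ENNReal.ofReal (φ y) ∂(walkMinLaw (P.map (X (δ n))) 0)) atTop (nhds 0) := by
    have hz : Tendsto (fun n => ENNReal.ofReal (1 - Real.exp (-(r * δ n))) * ENNReal.ofReal C)
        atTop (nhds 0) := by
      have := ENNReal.tendsto_ofReal (he.const_sub 1)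
      simpa using ENNReal.Tendsto.mul_const this (Or.inr ENNReal.ofReal_ne_top)
    refine tendsto_of_tendsto_of_tendsto_of_le_of_le tendsto_const_nhds hz (fun _ => zero_le)
      fun n => mul_le_mul_right (hle _ ?_) _
    have := hX.isProbabilityMeasure_map (hδ n).le
    infer_instance
  have h2 : Tendsto (fun n => ∫⁻ q, ENNReal.ofReal (φ (gridInf X (δ n)
      (⌊q.1 / (r * δ n)⌋₊ + 1) q.2)) ∂(expLaw.prod P)) atTop
      (nhds (∫⁻ y, ENNReal.ofReal (φ y) ∂(infLaw P X r))) := by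
    rw [infLaw, lintegral_map' hψ.aemeasurable (hX.aemeasurable_runInf_prod hr)]
    refine tendsto_lintegral_of_dominated_convergence (fun _ => ENNReal.ofReal C)
      (fun n => hψ.comp (hX.measurable_gridInf_floor (hδ n) _))
      (fun n => Eventually.of_forall fun q => ENNReal.ofReal_le_ofReal (hC _))
      (by simp) ?_
    filter_upwards [hX.tendsto_gridInf_floor hr hδ hδ0] with q hq
    exact ENNReal.tendsto_ofReal ((hφ.tendsto _).comp hq)
  have h3 := h1.add (ENNReal.Tendsto.mul (ENNReal.tendsto_ofReal he) (Or.inl (by simp)) h2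
    (Or.inr ENNReal.ofReal_ne_top))
  rw [ENNReal.ofReal_one, one_mul, zero_add] at h3
  exact h3.congr fun n => (hX.lintegral_killedLaw_eq (hδ n) (mul_pos hr (hδ n)) hψ).symm

theorem IsLevy.tendsto_priceFn_killedLaw (hX : IsLevy P ℱ X) {r : ℝ} (hr : 0 < r) {δ : ℕ → ℝ}
    (hδ : ∀ n, 0 < δ n) (hδ0 : Tendsto δ atTop (nhds 0)) {K : ℝ} (hK : 0 ≤ K) (x : ℝ) :
    Tendsto (fun n => priceFn K (killedLaw (P.map (X (δ n))) (Real.exp (-(r * δ n)))) x) atTop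
      (nhds (priceFn K (infLaw P X r) x)) := by
  have := hX.isProb
  have hρ : ∀ n, IsProbabilityMeasure (P.map (X (δ n))) := fun n =>
    hX.isProbabilityMeasure_map (hδ n).le
  have hp := hX.isProbabilityMeasure_infLaw hr
  have hks : ∀ n, IsProbabilityMeasure (killedLaw (P.map (X (δ n))) (Real.exp (-(r * δ n)))) :=
    fun n => isProbabilityMeasure_killedLaw _ (Real.exp_pos _).le (exp_neg_mul_lt_one hr (hδ n))
  exact tendsto_priceFn (hX.infLaw_ae_nonpos hr) (fun n => killedLaw_ae_nonpos _ _)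
    (hX.tendsto_integral_killedLaw hr hδ hδ0) hK x

end InfLaw

/-! ### The value function for positive discount rates -/

/-- The smallest point of the grid `δℕ` not before `τ`. -/
def ceilTime (δ : ℝ) (τ : Ω → ℝ≥0∞) (ω : Ω) : ℝ≥0∞ :=
  if τ ω = ∞ then ∞ else ENNReal.ofReal ((⌈(τ ω).toReal / δ⌉₊ : ℝ) * δ)

theorem ceilTime_eq_top_or (δ : ℝ) (τ : Ω → ℝ≥0∞) (ω : Ω) :
    ceilTime δ τ ω = ∞ ∨ ∃ j : ℕ, ceilTime δ τ ω = ENNReal.ofReal ((j : ℝ) * δ) := by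
  unfold ceilTime
  split_ifs
  · exact Or.inl rfl
  · exact Or.inr ⟨_, rfl⟩

theorem ceilTime_eq_iff {δ : ℝ} (hδ : 0 < δ) (τ : Ω → ℝ≥0∞) (ω : Ω) (j : ℕ) :
    ceilTime δ τ ω = ENNReal.ofReal ((j : ℝ) * δ) ↔
      τ ω ≤ ENNReal.ofReal ((j : ℝ) * δ) ∧
        ∀ i : ℕ, i < j → ¬ τ ω ≤ ENNReal.ofReal ((i : ℝ) * δ) := by
  have hle : ∀ i : ℕ, τ ω ≠ ∞ → (τ ω ≤ ENNReal.ofReal ((i : ℝ) * δ) ↔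
      ⌈(τ ω).toReal / δ⌉₊ ≤ i) := by
    intro i h
    rw [Nat.ceil_le, div_le_iff₀ hδ, ENNReal.le_ofReal_iff_toReal_le h (by positivity)]
  unfold ceilTime
  split_ifs with h
  · simp only [h, top_le_iff, ENNReal.ofReal_ne_top, ENNReal.ofReal_ne_top.symm, false_and]
  · rw [ENNReal.ofReal_eq_ofReal_iff (by positivity) (by positivity), hle j h,
      mul_left_inj' hδ.ne', Nat.cast_inj]
    simp only [hle _ h, not_le]
    constructor
    · rintro rfl
      exact ⟨le_rfl, fun i hi => hi⟩
    · rintro ⟨h1, h2⟩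
      refine le_antisymm h1 (not_lt.1 fun h3 => lt_irrefl _ (h2 _ h3))

section Value

variable [m0 : MeasurableSpace Ω] {P : Measure Ω} {ℱ : Filtration ℝ m0} {X : ℝ → Ω → ℝ}

theorem IsStopTime.measurableSet_ceilTime_eq {τ : Ω → ℝ≥0∞} (hτ : IsStopTime ℱ τ) {δ : ℝ}
    (hδ : 0 < δ) (j : ℕ) :
    MeasurableSet[ℱ ((j : ℝ) * δ)] {ω | ceilTime δ τ ω = ENNReal.ofReal ((j : ℝ) * δ)} := by
  have : {ω | ceilTime δ τ ω = ENNReal.ofReal ((j : ℝ) * δ)} =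
      {ω | τ ω ≤ ENNReal.ofReal ((j : ℝ) * δ)} ∩
        ⋂ i : ℕ, ⋂ _ : i < j, {ω | τ ω ≤ ENNReal.ofReal ((i : ℝ) * δ)}ᶜ := by
    ext ω
    simp only [mem_inter_iff, mem_iInter, mem_compl_iff, mem_ofPred_eq]
    exact ceilTime_eq_iff hδ τ ω j
  rw [this]
  refine MeasurableSet.inter (hτ _ (by positivity)) ?_
  refine MeasurableSet.iInter fun i => MeasurableSet.iInter fun hi => ?_
  refine ℱ.mono ?_ _ (hτ _ (by positivity)).compl
  gcongr

theorem IsLevy.tendsto_putPayoff_ceilTime (hX : IsLevy P ℱ X) (r K x : ℝ) {δ : ℕ → ℝ}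
    (hδ : ∀ n, 0 < δ n) (hδ0 : Tendsto δ atTop (nhds 0)) (τ : Ω → ℝ≥0∞) (ω : Ω) :
    Tendsto (fun n => putPayoff X r K x (ceilTime (δ n) τ) ω) atTop
      (nhds (putPayoff X r K x τ ω)) := by
  by_cases h : τ ω = ∞
  · simp [putPayoff, stopPayoff, ceilTime, h]
  · set t := (τ ω).toReal with ht
    have ht0 : 0 ≤ t := ENNReal.toReal_nonneg
    have hs : ∀ n, t ≤ (⌈t / δ n⌉₊ : ℝ) * δ n ∧ (⌈t / δ n⌉₊ : ℝ) * δ n ≤ t + δ n := by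
      intro n
      have h1 := Nat.le_ceil (t / δ n)
      have h2 := (Nat.ceil_lt_add_one (div_nonneg ht0 (hδ n).le)).le
      refine ⟨(div_le_iff₀ (hδ n)).1 h1, ?_⟩
      calc _ ≤ (t / δ n + 1) * δ n := mul_le_mul_of_nonneg_right h2 (hδ n).le
        _ = t + δ n := by rw [add_mul, div_mul_cancel₀ _ (hδ n).ne', one_mul]
    have hs0 : Tendsto (fun n => (⌈t / δ n⌉₊ : ℝ) * δ n) atTop (nhds t) :=
      tendsto_of_tendsto_of_tendsto_of_le_of_le tendsto_const_nhds
        (by simpa using hδ0.const_add t) (fun n => (hs n).1) fun n => (hs n).2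
    have hXs : Tendsto (fun n => X ((⌈t / δ n⌉₊ : ℝ) * δ n) ω) atTop (nhds (X t ω)) :=
      (hX.rightCont ω t ht0).tendsto.comp
        (tendsto_nhdsWithin_iff.2 ⟨hs0, Eventually.of_forall fun n => (hs n).1⟩)
    have hc : Continuous fun q : ℝ × ℝ => Real.exp (-(r * q.1)) * max (K - Real.exp (x + q.2)) 0 := by
      fun_prop
    have hlim := (hc.tendsto (t, X t ω)).comp (hs0.prodMk_nhds hXs)
    have h1 : putPayoff X r K x τ ω = Real.exp (-(r * t)) * max (K - Real.exp (x + X t ω)) 0 := by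
      simp [putPayoff, stopPayoff, h, ht]
    rw [h1]
    refine hlim.congr fun n => ?_
    have hnn : 0 ≤ (⌈t / δ n⌉₊ : ℝ) * δ n := ht0.trans (hs n).1
    simp only [putPayoff, stopPayoff, ceilTime, if_neg h, ← ht, Function.comp_apply,
      ENNReal.toReal_ofReal hnn]
    rw [if_pos ENNReal.ofReal_ne_top]

theorem IsLevy.measurable_putPayoff_ceilTime (hX : IsLevy P ℱ X) (r K x : ℝ) {δ : ℝ} (hδ : 0 < δ)
    {τ : Ω → ℝ≥0∞} (hτ : IsStopTime ℱ τ) : Measurable (putPayoff X r K x (ceilTime δ τ)) :=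
  hX.measurable_putPayoff_grid r K x hδ (ceilTime_eq_top_or δ τ) (hτ.measurableSet_ceilTime_eq hδ)

theorem IsLevy.measurable_putPayoff (hX : IsLevy P ℱ X) (r K x : ℝ) {τ : Ω → ℝ≥0∞}
    (hτ : IsStopTime ℱ τ) : Measurable (putPayoff X r K x τ) :=
  measurable_of_tendsto_metrizable
    (fun n : ℕ => hX.measurable_putPayoff_ceilTime r K x (δ := 1 / ((n : ℝ) + 1))
      (by positivity) hτ)
    (tendsto_pi_nhds.2 fun ω => hX.tendsto_putPayoff_ceilTime r K x (fun n => by positivity)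
      tendsto_one_div_nat τ ω)

theorem IsLevy.bddAbove_integral_putPayoff (hX : IsLevy P ℱ X) {r K : ℝ} (hr : 0 ≤ r) (hK : 0 ≤ K)
    (x : ℝ) : BddAbove (range fun τ : {τ : Ω → ℝ≥0∞ // IsStopTime ℱ τ} =>
      ∫ ω, putPayoff X r K x τ.1 ω ∂P) := by
  have := hX.isProb
  refine ⟨K, ?_⟩
  rintro _ ⟨τ, rfl⟩
  have hint : Integrable (putPayoff X r K x τ.1) P := integrable_of_bounds
    (hX.measurable_putPayoff r K x τ.2).aestronglyMeasurable
    (putPayoff_nonneg X r K x τ.1) (putPayoff_le X hr hK x τ.1)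
  calc ∫ ω, putPayoff X r K x τ.1 ω ∂P ≤ ∫ _, K ∂P :=
        integral_mono hint (integrable_const K) (putPayoff_le X hr hK x τ.1)
    _ = K := by simp

theorem IsLevy.integral_putPayoff_le_putValue (hX : IsLevy P ℱ X) {r K : ℝ} (hr : 0 ≤ r)
    (hK : 0 ≤ K) (x : ℝ) {τ : Ω → ℝ≥0∞} (hτ : IsStopTime ℱ τ) :
    ∫ ω, putPayoff X r K x τ ω ∂P ≤ putValue P ℱ X r K x :=
  le_ciSup (hX.bddAbove_integral_putPayoff hr hK x) ⟨τ, hτ⟩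

theorem putValue_le {r K x B : ℝ}
    (h : ∀ τ, IsStopTime ℱ τ → ∫ ω, putPayoff X r K x τ ω ∂P ≤ B) : putValue P ℱ X r K x ≤ B := by
  have : Nonempty {τ : Ω → ℝ≥0∞ // IsStopTime ℱ τ} :=
    ⟨⟨fun _ => ∞, fun t _ => by simp⟩⟩
  exact ciSup_le fun τ => h τ.1 τ.2

theorem IsLevy.integral_putPayoff_le_priceFn (hX : IsLevy P ℱ X) {r K : ℝ} (hr : 0 < r)
    (hK : 0 < K) (x : ℝ) {τ : Ω → ℝ≥0∞} (hτ : IsStopTime ℱ τ) :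
    ∫ ω, putPayoff X r K x τ ω ∂P ≤ priceFn K (infLaw P X r) x := by
  have := hX.isProb
  have hδ : ∀ n : ℕ, 0 < 1 / ((n : ℝ) + 1) := fun n => by positivity
  refine le_of_tendsto_of_tendsto' (tendsto_integral_of_dominated_convergence (fun _ => K)
    (fun n => (hX.measurable_putPayoff_ceilTime r K x (hδ n) hτ).aestronglyMeasurable)
    (integrable_const K) (fun n => Eventually.of_forall fun ω => ?_)
    (Eventually.of_forall fun ω =>
      hX.tendsto_putPayoff_ceilTime r K x hδ tendsto_one_div_nat τ ω))
    (hX.tendsto_priceFn_killedLaw hr hδ tendsto_one_div_nat hK.le x) fun n => ?_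
  · rw [Real.norm_eq_abs, abs_of_nonneg (putPayoff_nonneg X r K x _ ω)]
    exact putPayoff_le X hr.le hK.le x _ ω
  · exact hX.integral_putPayoff_grid_le hr hK x (hδ n) (ceilTime_eq_top_or _ τ)
      (hτ.measurableSet_ceilTime_eq (hδ n))

theorem IsLevy.putValue_eq_priceFn_infLaw (hX : IsLevy P ℱ X) {r K : ℝ} (hr : 0 < r)
    (hK : 0 < K) (x : ℝ) : putValue P ℱ X r K x = priceFn K (infLaw P X r) x := by
  refine le_antisymm (putValue_le fun τ hτ => hX.integral_putPayoff_le_priceFn hr hK x hτ) ?_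
  have hδ : ∀ n : ℕ, 0 < 1 / ((n : ℝ) + 1) := fun n => by positivity
  refine le_of_tendsto' (hX.tendsto_priceFn_killedLaw hr hδ tendsto_one_div_nat hK.le x)
    fun n => ?_
  obtain ⟨τ, hτ, h⟩ := hX.exists_priceFn_le hr hK x (hδ n)
  exact h.trans (hX.integral_putPayoff_le_putValue hr.le hK.le x hτ)

end Value

/-! ### Differentiability of the price function at the critical point -/

section Derivative

variable {ν : Measure ℝ} [IsProbabilityMeasure ν]

theorem lipschitzOnWith_put (c x y : ℝ) (hy : y ≤ 0) :
    LipschitzOnWith (Real.nnabs (Real.exp (x + 1))) (fun z => max (c - Real.exp (z + y)) 0)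
      (Metric.ball x 1) := by
  have hexp : LipschitzOnWith (Real.nnabs (Real.exp (x + 1))) (fun z => Real.exp (z + y))
      (Metric.ball x 1) := by
    refine (convex_ball x 1).lipschitzOnWith_of_nnnorm_hasDerivWithin_le
      (f' := fun z => Real.exp (z + y))
      (fun z _ => ((Real.hasDerivAt_exp (z + y)).comp_add_const z y).hasDerivWithinAt)
      fun z hz => ?_
    rw [← NNReal.coe_le_coe, coe_nnnorm, Real.coe_nnabs, Real.norm_eq_abs,
      abs_of_pos (Real.exp_pos _), abs_of_pos (Real.exp_pos _)]
    rw [Metric.mem_ball, Real.dist_eq] at hz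
    exact Real.exp_le_exp.2 (by linarith [(abs_lt.1 hz).2])
  refine LipschitzOnWith.of_dist_le_mul fun u hu v hv => ?_
  refine le_trans ?_ (hexp.dist_le_mul u hu v hv)
  rw [Real.dist_eq, Real.dist_eq]
  refine (abs_max_sub_max_le_abs _ _ _).trans (le_of_eq ?_)
  rw [sub_sub_sub_cancel_left, abs_sub_comm]

theorem hasDerivAt_integral_put (hν : ∀ᵐ y ∂ν, y ≤ 0) (h0 : ν {0} = 0) {c x : ℝ}
    (hx : Real.exp x = c) :
    HasDerivAt (fun x => ∫ y, max (c - Real.exp (x + y)) 0 ∂ν) (-(Real.exp x * expMean ν)) x := by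
  have hneg : ∀ᵐ y ∂ν, y < 0 := by
    have : ∀ᵐ y ∂ν, y ≠ 0 := by simpa [ae_iff] using h0
    filter_upwards [hν, this] with y h1 h2
    exact lt_of_le_of_ne h1 h2
  have h := (hasDerivAt_integral_of_dominated_loc_of_lip
    (F := fun x y => max (c - Real.exp (x + y)) 0) (F' := fun y => -Real.exp (x + y))
    (bound := fun _ => Real.exp (x + 1)) (μ := ν) (x₀ := x) (Metric.ball_mem_nhds x one_pos)
    (Eventually.of_forall fun z => (integrable_put hν c z).aestronglyMeasurable)
    (integrable_put hν c x) (by fun_prop)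
    (hν.mono fun y hy => lipschitzOnWith_put c x y hy) (integrable_const _) ?_).2
  · rwa [integral_neg, integral_exp_add] at h
  · filter_upwards [hneg] with y hy
    have hd : HasDerivAt (fun z => c - Real.exp (z + y)) (-Real.exp (x + y)) x := by
      simpa using ((Real.hasDerivAt_exp (x + y)).comp_add_const x y).const_sub c
    refine hd.congr_of_eventuallyEq ?_
    have hlt : Real.exp (x + y) < c := hx ▸ Real.exp_lt_exp.2 (by linarith)
    have hc : ContinuousAt (fun z => Real.exp (z + y)) x := by fun_prop
    filter_upwards [hc.eventually (gt_mem_nhds hlt)] with z hz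
    exact max_eq_left (sub_nonneg.2 (le_of_lt hz))

theorem nonneg_of_hasDerivAt_of_forall_ge {f : ℝ → ℝ} {f' x : ℝ} (hf : HasDerivAt f f' x)
    (h : ∀ z, x ≤ z → f x ≤ f z) : 0 ≤ f' := by
  have hs := (hasDerivAt_iff_tendsto_slope.1 hf).mono_left
    (nhdsWithin_mono x (fun z (hz : x < z) => ne_of_gt hz) : nhdsWithin x (Set.Ioi x) ≤ _)
  refine ge_of_tendsto hs ?_
  filter_upwards [self_mem_nhdsWithin] with z hz
  rw [slope_def_field]
  exact div_nonneg (sub_nonneg.2 (h z (le_of_lt hz))) (sub_nonneg.2 (le_of_lt hz))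

theorem measure_singleton_eq_zero_of_hasDerivAt (hν : ∀ᵐ y ∂ν, y ≤ 0) {c x : ℝ}
    (hx : Real.exp x = c)
    (hd : HasDerivAt (fun x => ∫ y, max (c - Real.exp (x + y)) 0 ∂ν)
      (-(Real.exp x * expMean ν)) x) : ν {0} = 0 := by
  set a := ν.real {0} with ha
  let H : ℝ → ℝ := fun z => (c - Real.exp z * expMean ν) + a * (Real.exp z - c)
  have hH : HasDerivAt H (-(Real.exp x * expMean ν) + a * Real.exp x) x :=
    (((Real.hasDerivAt_exp x).mul_const _).const_sub c).add
      (((Real.hasDerivAt_exp x).sub_const c).const_mul a)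
  have hle : ∀ z, x ≤ z → H z ≤ ∫ y, max (c - Real.exp (z + y)) 0 ∂ν := by
    intro z hz
    have hi : Integrable (({0} : Set ℝ).indicator fun _ => Real.exp z - c) ν :=
      (integrable_const _).indicator (measurableSet_singleton 0)
    have hi' : Integrable (fun y => c - Real.exp (z + y)) ν :=
      (integrable_const c).sub (integrable_exp_of_ae_nonpos hν z)
    have : H z = ∫ y, ((c - Real.exp (z + y)) +
        ({0} : Set ℝ).indicator (fun _ => Real.exp z - c) y) ∂ν := by
      rw [integral_add hi' hi, integral_const_sub_exp hν,
        integral_indicator (measurableSet_singleton 0), setIntegral_const, smul_eq_mul]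
    rw [this]
    refine integral_mono (hi'.add hi) (integrable_put hν c z) fun y => ?_
    by_cases hy : y = 0
    · simp [hy]
    · simp [hy]
  have heq : H x = ∫ y, max (c - Real.exp (x + y)) 0 ∂ν := by
    have : ∫ y, max (c - Real.exp (x + y)) 0 ∂ν = ∫ y, (c - Real.exp (x + y)) ∂ν := by
      refine integral_congr_ae ?_
      filter_upwards [hν] with y hy
      refine max_eq_left (sub_nonneg.2 ?_)
      rw [← hx]
      exact Real.exp_le_exp.2 (by linarith)
    rw [this, integral_const_sub_exp hν]
    simp [H, hx]
  have h := nonneg_of_hasDerivAt_of_forall_ge (hd.sub hH) fun z hz => by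
    simpa [heq] using hle z hz
  have hax : a * Real.exp x ≤ 0 := by linarith
  have : a ≤ 0 := by
    by_contra! hpos
    linarith [mul_pos hpos (Real.exp_pos x)]
  have ha0 : a = 0 := le_antisymm this measureReal_nonneg
  rwa [ha, measureReal_eq_zero_iff] at ha0

theorem hasDerivAt_priceFn_iff (hν : ∀ᵐ y ∂ν, y ≤ 0) {K : ℝ} (hK : 0 < K) :
    HasDerivAt (priceFn K ν) (-Real.exp (Real.log (K * expMean ν)))
      (Real.log (K * expMean ν)) ↔ ν {0} = 0 := by
  have hm := expMean_pos hν
  set x := Real.log (K * expMean ν)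
  have hx : Real.exp x = K * expMean ν := Real.exp_log (mul_pos hK hm)
  constructor
  · intro h
    refine measure_singleton_eq_zero_of_hasDerivAt hν hx ?_
    have h' := h.mul_const (expMean ν)
    simp only [priceFn, div_mul_cancel₀ _ hm.ne', neg_mul] at h'
    exact h'
  · intro h
    have h' := (hasDerivAt_integral_put hν h hx).div_const (expMean ν)
    rwa [neg_div, mul_div_cancel_right₀ _ hm.ne'] at h'

end Derivative

/-! ### The all-time infimum -/

theorem putPayoff_le_putPayoff_zero (X : ℝ → Ω → ℝ) {r : ℝ} (hr : 0 ≤ r) (K x : ℝ)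
    (τ : Ω → ℝ≥0∞) (ω : Ω) : putPayoff X r K x τ ω ≤ putPayoff X 0 K x τ ω := by
  unfold putPayoff stopPayoff
  split_ifs
  · refine mul_le_mul_of_nonneg_right (Real.exp_le_exp.2 ?_) (le_max_right _ _)
    have : 0 ≤ r * (τ ω).toReal := by positivity
    linarith
  · exact le_rfl

theorem tendsto_putPayoff_zero (X : ℝ → Ω → ℝ) {r : ℕ → ℝ} (hr0 : Tendsto r atTop (nhds 0))
    (K x : ℝ) (τ : Ω → ℝ≥0∞) (ω : Ω) :
    Tendsto (fun n => putPayoff X (r n) K x τ ω) atTop (nhds (putPayoff X 0 K x τ ω)) := by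
  unfold putPayoff stopPayoff
  split_ifs
  · have hc : Continuous fun s : ℝ => Real.exp (-(s * (τ ω).toReal)) *
        max (K - Real.exp (x + X (τ ω).toReal ω)) 0 := by fun_prop
    exact (hc.tendsto 0).comp hr0
  · exact tendsto_const_nhds

section AllTime

variable [m0 : MeasurableSpace Ω] {P : Measure Ω} {ℱ : Filtration ℝ m0} {X : ℝ → Ω → ℝ}

theorem IsLevy.measurableSet_forall_ge (hX : IsLevy P ℱ X) {t : ℝ} (ht : 0 ≤ t) (c : ℝ) :
    MeasurableSet {ω | ∀ s, t ≤ s → c ≤ X s ω} := by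
  have : {ω | ∀ s, t ≤ s → c ≤ X s ω} = ⋂ q : ℚ, ⋂ _ : t ≤ (q : ℝ), {ω | c ≤ X q ω} := by
    ext ω
    simp only [mem_ofPred_eq, mem_iInter]
    refine ⟨fun h q hq => h q hq, fun h s hs => ?_⟩
    by_contra! hlt
    obtain ⟨η, hη, hη'⟩ := hX.exists_forall_Ico ω (ht.trans hs) (gt_mem_nhds hlt)
    obtain ⟨q, hq1, hq2⟩ := exists_rat_btwn (lt_add_of_pos_right s hη)
    exact absurd (h q (hs.trans hq1.le)) (not_le.2 (hη' q hq1.le hq2))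
  rw [this]
  exact MeasurableSet.iInter fun q => MeasurableSet.iInter fun hq =>
    hX.measurable (ht.trans hq) measurableSet_Ici

theorem IsLevy.measurableSet_tendsto_atTop (hX : IsLevy P ℱ X) :
    MeasurableSet {ω | Tendsto (fun t => X t ω) atTop atTop} := by
  have : {ω | Tendsto (fun t => X t ω) atTop atTop} =
      ⋂ m : ℕ, ⋃ n : ℕ, {ω | ∀ s, (n : ℝ) ≤ s → (m : ℝ) ≤ X s ω} := by
    ext ω
    simp only [mem_ofPred_eq, mem_iInter, mem_iUnion]
    constructor
    · intro h m
      obtain ⟨t, ht⟩ := eventually_atTop.1 (tendsto_atTop.1 h m)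
      obtain ⟨n, hn⟩ := exists_nat_ge t
      exact ⟨n, fun s hs => ht s (hn.trans hs)⟩
    · refine fun h => tendsto_atTop.2 fun b => ?_
      obtain ⟨m, hm⟩ := exists_nat_ge b
      obtain ⟨n, hn⟩ := h m
      filter_upwards [eventually_ge_atTop (n : ℝ)] with s hs
      exact hm.trans (hn s hs)
  rw [this]
  exact MeasurableSet.iInter fun m => MeasurableSet.iUnion fun n =>
    hX.measurableSet_forall_ge n.cast_nonneg _

theorem IsLevy.ae_tendsto_atTop (hX : IsLevy P ℱ X)
    (h : P {ω | Tendsto (fun t => X t ω) atTop atTop} = 1) :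
    ∀ᵐ ω ∂P, Tendsto (fun t => X t ω) atTop atTop := by
  have := hX.isProb
  exact (mem_ae_iff_prob_eq_one hX.measurableSet_tendsto_atTop).2 h

theorem IsLevy.bddBelow_image_Ici (hX : IsLevy P ℱ X) {ω : Ω}
    (hω : Tendsto (fun t => X t ω) atTop atTop) :
    BddBelow ((fun s => X s ω) '' Set.Ici 0) := by
  obtain ⟨t, ht⟩ := eventually_atTop.1 (tendsto_atTop.1 hω 0)
  refine ((hX.bddBelow_image_Icc ω t).union (⟨0, ?_⟩ :
    BddBelow ((fun s => X s ω) '' Set.Ici t))).mono ?_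
  · rintro _ ⟨s, hs, rfl⟩
    exact ht s hs
  · rw [← image_union]
    refine image_mono fun s hs => ?_
    rcases le_total s t with h | h
    · exact Or.inl ⟨hs, h⟩
    · exact Or.inr h

theorem IsLevy.infAll_le (hX : IsLevy P ℱ X) {ω : Ω}
    (hω : Tendsto (fun t => X t ω) atTop atTop) {s : ℝ} (hs : 0 ≤ s) : infAll X ω ≤ X s ω :=
  csInf_le (hX.bddBelow_image_Ici hω) ⟨s, hs, rfl⟩

theorem IsLevy.tendsto_runInf_infAll (hX : IsLevy P ℱ X) {ω : Ω}
    (hω : Tendsto (fun t => X t ω) atTop atTop) :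
    Tendsto (fun t => runInf X t ω) atTop (nhds (infAll X ω)) := by
  rw [tendsto_order]
  constructor
  · intro c hc
    filter_upwards [eventually_ge_atTop 0] with t ht
    exact hc.trans_le (le_runInf X ω ht fun s hs _ => hX.infAll_le hω hs)
  · intro c hc
    obtain ⟨_, ⟨s, hs, rfl⟩, hlt⟩ := exists_lt_of_csInf_lt
      (⟨_, 0, le_refl (0 : ℝ), rfl⟩ : ((fun s => X s ω) '' Set.Ici 0).Nonempty) hc
    filter_upwards [eventually_ge_atTop s] with t ht
    exact (hX.runInf_le ω hs ht).trans_lt hlt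

theorem IsLevy.aemeasurable_infAll (hX : IsLevy P ℱ X)
    (hT : ∀ᵐ ω ∂P, Tendsto (fun t => X t ω) atTop atTop) : AEMeasurable (infAll X) P :=
  aemeasurable_of_tendsto_metrizable_ae atTop
    (fun n : ℕ => (hX.measurable_runInf (t := n) n.cast_nonneg).aemeasurable)
    (hT.mono fun _ hω => (hX.tendsto_runInf_infAll hω).comp tendsto_natCast_atTop_atTop)

theorem IsLevy.map_infAll_ae_nonpos (hX : IsLevy P ℱ X)
    (hT : ∀ᵐ ω ∂P, Tendsto (fun t => X t ω) atTop atTop) :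
    ∀ᵐ y ∂(P.map (infAll X)), y ≤ 0 := by
  rw [ae_map_iff (hX.aemeasurable_infAll hT) measurableSet_Iic]
  filter_upwards [hT, hX.zero] with ω hω h0
  exact h0 ▸ hX.infAll_le hω le_rfl

theorem IsLevy.tendsto_integral_infLaw (hX : IsLevy P ℱ X)
    (hT : ∀ᵐ ω ∂P, Tendsto (fun t => X t ω) atTop atTop) {r : ℕ → ℝ} (hr : ∀ n, 0 < r n)
    (hr0 : Tendsto r atTop (nhds 0)) (C : ℝ) (φ : ℝ → ℝ) (hφ : Continuous φ)
    (h0 : ∀ y, 0 ≤ φ y) (hC : ∀ y, φ y ≤ C) :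
    Tendsto (fun n => ∫ y, φ y ∂(infLaw P X (r n))) atTop
      (nhds (∫ y, φ y ∂(P.map (infAll X)))) := by
  have := hX.isProb
  have hsnd : ∫ y, φ y ∂(P.map (infAll X)) = ∫ q, φ (infAll X q.2) ∂(expLaw.prod P) := by
    rw [integral_map (hX.aemeasurable_infAll hT) hφ.aestronglyMeasurable,
      integral_fun_snd (fun ω => φ (infAll X ω))]
    simp
  have hmap : ∀ n, ∫ y, φ y ∂(infLaw P X (r n)) =
      ∫ q, φ (runInf X (q.1 / r n) q.2) ∂(expLaw.prod P) := fun n =>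
    integral_map (hX.aemeasurable_runInf_prod (hr n)) hφ.aestronglyMeasurable
  simp only [hsnd, hmap]
  refine tendsto_integral_of_dominated_convergence (fun _ => C)
    (fun n => (hφ.measurable.comp_aemeasurable
      (hX.aemeasurable_runInf_prod (hr n))).aestronglyMeasurable) (integrable_const C)
    (fun n => Eventually.of_forall fun q => ?_) ?_
  · rw [Real.norm_eq_abs, abs_of_nonneg (h0 _)]
    exact hC _
  · filter_upwards [hX.ae_expLaw_prod_pos, Measure.quasiMeasurePreserving_snd.ae hT] with q hq hω
    refine (hφ.tendsto _).comp ((hX.tendsto_runInf_infAll hω).comp ?_)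
    have : Tendsto (fun n => (r n)⁻¹) atTop atTop := tendsto_inv_nhdsGT_zero.comp
      (tendsto_nhdsWithin_iff.2 ⟨hr0, Eventually.of_forall hr⟩)
    simpa only [div_eq_mul_inv] using this.const_mul_atTop hq

theorem IsLevy.tendsto_priceFn_infLaw (hX : IsLevy P ℱ X)
    (hT : ∀ᵐ ω ∂P, Tendsto (fun t => X t ω) atTop atTop) {r : ℕ → ℝ} (hr : ∀ n, 0 < r n)
    (hr0 : Tendsto r atTop (nhds 0)) {K : ℝ} (hK : 0 ≤ K) (x : ℝ) :
    Tendsto (fun n => priceFn K (infLaw P X (r n)) x) atTop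
      (nhds (priceFn K (P.map (infAll X)) x)) := by
  have := hX.isProb
  have := fun n => hX.isProbabilityMeasure_infLaw (hr n)
  have : IsProbabilityMeasure (P.map (infAll X)) :=
    Measure.isProbabilityMeasure_map (hX.aemeasurable_infAll hT)
  exact tendsto_priceFn (hX.map_infAll_ae_nonpos hT) (fun n => hX.infLaw_ae_nonpos (hr n))
    (hX.tendsto_integral_infLaw hT hr hr0) hK x

theorem IsLevy.integrable_putPayoff (hX : IsLevy P ℱ X) {r K : ℝ} (hr : 0 ≤ r) (hK : 0 ≤ K)
    (x : ℝ) {τ : Ω → ℝ≥0∞} (hτ : IsStopTime ℱ τ) : Integrable (putPayoff X r K x τ) P := by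
  have := hX.isProb
  exact integrable_of_bounds (hX.measurable_putPayoff r K x hτ).aestronglyMeasurable
    (putPayoff_nonneg X r K x τ) (putPayoff_le X hr hK x τ)

theorem IsLevy.putValue_zero_eq_priceFn (hX : IsLevy P ℱ X)
    (hT : ∀ᵐ ω ∂P, Tendsto (fun t => X t ω) atTop atTop) {K : ℝ} (hK : 0 < K) (x : ℝ) :
    putValue P ℱ X 0 K x = priceFn K (P.map (infAll X)) x := by
  have := hX.isProb
  have hr : ∀ n : ℕ, 0 < 1 / ((n : ℝ) + 1) := fun n => by positivity
  have hlim := hX.tendsto_priceFn_infLaw hT hr tendsto_one_div_nat hK.le x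
  refine le_antisymm (putValue_le fun τ hτ => ?_) (le_of_tendsto' hlim fun n => ?_)
  · refine le_of_tendsto_of_tendsto' (tendsto_integral_of_dominated_convergence (fun _ => K)
      (fun n => (hX.measurable_putPayoff _ K x hτ).aestronglyMeasurable) (integrable_const K)
      (fun n => Eventually.of_forall fun ω => ?_)
      (Eventually.of_forall fun ω => tendsto_putPayoff_zero X tendsto_one_div_nat K x τ ω))
      hlim fun n => hX.integral_putPayoff_le_priceFn (hr n) hK x hτ
    rw [Real.norm_eq_abs, abs_of_nonneg (putPayoff_nonneg X _ K x _ ω)]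
    exact putPayoff_le X (hr n).le hK.le x _ ω
  · rw [← hX.putValue_eq_priceFn_infLaw (hr n) hK x]
    refine putValue_le fun τ hτ => le_trans ?_
      (hX.integral_putPayoff_le_putValue le_rfl hK.le x hτ)
    exact integral_mono (hX.integrable_putPayoff (hr n).le hK.le x hτ)
      (hX.integrable_putPayoff le_rfl hK.le x hτ)
      (putPayoff_le_putPayoff_zero X (hr n).le K x τ)

theorem IsLevy.mInf_zero_eq_expMean (hX : IsLevy P ℱ X)
    (hT : ∀ᵐ ω ∂P, Tendsto (fun t => X t ω) atTop atTop) :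
    mInf P X 0 = expMean (P.map (infAll X)) := by
  rw [mInf, if_neg (lt_irrefl _), expMean, integral_map (hX.aemeasurable_infAll hT)
    Real.continuous_exp.aestronglyMeasurable]

theorem IsLevy.mInf_eq_expMean_infLaw (hX : IsLevy P ℱ X) {r : ℝ} (hr : 0 < r) :
    mInf P X r = expMean (infLaw P X r) := by
  have := hX.isProb
  have hint : Integrable (fun q : ℝ × Ω => Real.exp (runInf X (q.1 / r) q.2)) (expLaw.prod P) := by
    refine Integrable.of_bound (C := 1) (Real.continuous_exp.measurable.comp_aemeasurable
      (hX.aemeasurable_runInf_prod hr)).aestronglyMeasurable ?_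
    filter_upwards [hX.ae_expLaw_prod_pos,
      Measure.quasiMeasurePreserving_snd.ae hX.runInf_nonpos] with q h1 h2
    rw [Real.norm_eq_abs, abs_of_pos (Real.exp_pos _)]
    exact Real.exp_le_one_iff.2 (h2 _ (by positivity))
  rw [mInf, if_pos hr, expMean, infLaw, integral_map (hX.aemeasurable_runInf_prod hr)
    Real.continuous_exp.aestronglyMeasurable, integral_prod _ hint, integral_expLaw]
  have h := integral_comp_mul_left_Ioi
    (fun t => Real.exp (-t) * ∫ ω, Real.exp (runInf X (t / r) ω) ∂P) 0 hr
  rw [mul_zero, smul_eq_mul, eq_inv_mul_iff_mul_eq₀ hr.ne', ← integral_const_mul] at h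
  rw [← h]
  refine integral_congr_ae (Eventually.of_forall fun t => ?_)
  simp only [mul_div_cancel_left₀ _ hr.ne', mul_assoc]

end AllTime

/-! ### Regularity of the lower half-line -/

section Regularity

variable [m0 : MeasurableSpace Ω] {P : Measure Ω} {ℱ : Filtration ℝ m0} {X : ℝ → Ω → ℝ}

theorem IsLevy.measurableSet_regularBelow (hX : IsLevy P ℱ X) : MeasurableSet (regularBelow X) := by
  have : regularBelow X = ⋂ n : ℕ, ⋃ q : ℚ, ⋃ _ : 0 ≤ (q : ℝ) ∧ (q : ℝ) < 1 / ((n : ℝ) + 1),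
      {ω | X q ω < 0} := by
    ext ω
    simp only [regularBelow, mem_ofPred_eq, mem_iInter, mem_iUnion, exists_prop]
    constructor
    · intro h n
      obtain ⟨t, ht0, htn, ht⟩ := h (1 / ((n : ℝ) + 1)) (by positivity)
      obtain ⟨η, hη, hη'⟩ := hX.exists_forall_Ico ω ht0 (gt_mem_nhds ht)
      obtain ⟨q, hq1, hq2⟩ := exists_rat_btwn
        (lt_min (lt_add_of_pos_right t hη) htn : t < min (t + η) (1 / ((n : ℝ) + 1)))
      exact ⟨q, ⟨ht0.trans hq1.le, hq2.trans_le (min_le_right _ _)⟩,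
        hη' q hq1.le (hq2.trans_le (min_le_left _ _))⟩
    · intro h ε hε
      obtain ⟨n, hn⟩ := exists_nat_one_div_lt hε
      obtain ⟨q, ⟨hq0, hq1⟩, hq⟩ := h n
      exact ⟨q, hq0, hq1.trans hn, hq⟩
  rw [this]
  exact MeasurableSet.iInter fun n => MeasurableSet.iUnion fun q => MeasurableSet.iUnion fun hq =>
    hX.measurable hq.1 measurableSet_Iio

theorem IsLevy.measure_regularBelow_eq_one_iff (hX : IsLevy P ℱ X) :
    P (regularBelow X) = 1 ↔ ∀ᵐ ω ∂P, ω ∈ regularBelow X := by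
  have := hX.isProb
  exact (mem_ae_iff_prob_eq_one hX.measurableSet_regularBelow).symm

theorem IsLevy.runInf_neg_of_mem_regularBelow (hX : IsLevy P ℱ X) {ω : Ω}
    (hω : ω ∈ regularBelow X) {t : ℝ} (ht : 0 < t) : runInf X t ω < 0 := by
  obtain ⟨s, hs0, hst, hs⟩ := hω t ht
  exact (hX.runInf_le ω hs0 hst.le).trans_lt hs

theorem ae_mem_regularBelow
    (h : ∀ ε : ℝ, 0 < ε → ∃ t, 0 < t ∧ t < ε ∧ ∀ᵐ ω ∂P, runInf X t ω < 0) :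
    ∀ᵐ ω ∂P, ω ∈ regularBelow X := by
  choose t ht0 htn ht using fun n : ℕ => h (1 / ((n : ℝ) + 1)) (by positivity)
  filter_upwards [ae_all_iff.2 ht] with ω hω ε hε
  obtain ⟨n, hn⟩ := exists_nat_one_div_lt hε
  obtain ⟨s, hs0, hs1, hs⟩ := exists_lt_of_runInf_lt X ω (ht0 n).le (hω n)
  exact ⟨s, hs0, hs1.trans_lt ((htn n).trans hn), hs⟩

theorem IsLevy.infLaw_singleton_eq_zero_iff (hX : IsLevy P ℱ X) {r : ℝ} (hr : 0 < r) :
    infLaw P X r {0} = 0 ↔ ∀ᵐ ω ∂P, ω ∈ regularBelow X := by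
  have := hX.isProb
  have hiff : infLaw P X r {0} = 0 ↔ ∀ᵐ q ∂(expLaw.prod P), runInf X (q.1 / r) q.2 ≠ 0 := by
    rw [infLaw, Measure.map_apply_of_aemeasurable (hX.aemeasurable_runInf_prod hr)
      (measurableSet_singleton 0), ae_iff]
    simp [preimage]
  rw [hiff]
  constructor
  · intro h
    have h1 := Measure.ae_ae_of_ae_prod h
    have h2 : ∀ᵐ t ∂(volume.restrict (Set.Ioi (0 : ℝ))), ∀ᵐ ω ∂P, runInf X (t / r) ω ≠ 0 :=
      (withDensity_absolutelyContinuous' (by fun_prop)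
        (Eventually.of_forall fun t => by simp [Real.exp_pos])).ae_le h1
    have h3 := Measure.dense_of_ae ((ae_restrict_iff' measurableSet_Ioi).1 h2)
    refine ae_mem_regularBelow fun ε hε => ?_
    obtain ⟨t, ht, ht0, htε⟩ := h3.exists_between (mul_pos hr hε)
    refine ⟨t / r, by positivity, (div_lt_iff₀' hr).2 htε, ?_⟩
    filter_upwards [ht ht0, hX.runInf_nonpos] with ω hω1 hω2
    exact lt_of_le_of_ne (hω2 _ (by positivity)) hω1
  · intro h
    filter_upwards [hX.ae_expLaw_prod_pos, Measure.quasiMeasurePreserving_snd.ae h] with q h1 h2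
    exact (hX.runInf_neg_of_mem_regularBelow h2 (by positivity)).ne

theorem IsLevy.measure_inter_incMin_nonneg (hX : IsLevy P ℱ X) {δ : ℝ} (hδ : 0 < δ) (k j : ℕ)
    {A : Set Ω} (hA : MeasurableSet[ℱ ((j : ℝ) * δ)] A) :
    P (A ∩ {ω | 0 ≤ incMin X δ k j ω}) = P A * walkMinLaw (P.map (X δ)) k (Set.Ici 0) := by
  have := hX.isProb
  have hρ := hX.isProbabilityMeasure_map hδ.le
  have hA' := ℱ.le _ _ hA
  have hZ : Measurable[ℱ ((j : ℝ) * δ)] (A.indicator fun _ => (1 : ℝ)) :=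
    measurable_const.indicator hA
  have hZ' : Measurable (A.indicator fun _ => (1 : ℝ)) := measurable_const.indicator hA'
  have h := congrArg (fun μ => μ (({1} : Set ℝ) ×ˢ Set.Ici (0 : ℝ)))
    (hX.map_prodMk_incMin hδ k j ℝ _ hZ)
  have hpre : (A.indicator fun _ => (1 : ℝ)) ⁻¹' {1} = A := by
    ext ω
    by_cases hω : ω ∈ A <;> simp [hω]
  simp only [Measure.prod_prod] at h
  rw [Measure.map_apply (hZ'.prodMk (hX.measurable_incMin hδ k j))
    ((measurableSet_singleton 1).prod measurableSet_Ici),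
    Measure.map_apply hZ' (measurableSet_singleton 1), hpre, mk_preimage_prod, hpre] at h
  exact h

theorem IsLevy.measure_incMin_nonneg (hX : IsLevy P ℱ X) {δ : ℝ} (hδ : 0 < δ) (k j : ℕ) :
    P {ω | 0 ≤ incMin X δ k j ω} = walkMinLaw (P.map (X δ)) k (Set.Ici 0) := by
  have := hX.isProb
  simpa using hX.measure_inter_incMin_nonneg hδ k j MeasurableSet.univ

theorem IsLevy.walkMinLaw_Ici_antitone (hX : IsLevy P ℱ X) {δ : ℝ} (hδ : 0 < δ) :
    Antitone fun k => walkMinLaw (P.map (X δ)) k (Set.Ici 0) := by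
  intro k l hkl
  simp only [← hX.measure_incMin_nonneg hδ _ 0]
  refine measure_mono fun ω hω => ?_
  rw [mem_ofPred_eq, le_incMin_iff] at hω ⊢
  exact fun i hi => hω i (hi.trans hkl)

theorem IsLevy.mul_walkMinLaw_Ici_le (hX : IsLevy P ℱ X) {δ : ℝ} (hδ : 0 < δ) (j k : ℕ) :
    walkMinLaw (P.map (X δ)) j (Set.Ici 0) * walkMinLaw (P.map (X δ)) k (Set.Ici 0) ≤
      walkMinLaw (P.map (X δ)) (j + k) (Set.Ici 0) := by
  have hA : MeasurableSet[ℱ ((j : ℝ) * δ)] {ω | 0 ≤ incMin X δ j 0 ω} := by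
    have : {ω | 0 ≤ incMin X δ j 0 ω} = ⋂ i : ℕ, ⋂ _ : i ≤ j,
        {ω | 0 ≤ X (((0 + i : ℕ) : ℝ) * δ) ω - X (((0 : ℕ) : ℝ) * δ) ω} := by
      ext ω
      simp only [mem_ofPred_eq, mem_iInter, le_incMin_iff]
    rw [this]
    refine MeasurableSet.iInter fun i => MeasurableSet.iInter fun hi => ?_
    exact ((hX.measurable_grid hδ (by omega)).sub (hX.measurable_grid hδ j.zero_le))
      measurableSet_Ici
  rw [← hX.measure_incMin_nonneg hδ j 0, ← hX.measure_inter_incMin_nonneg hδ k j hA,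
    ← hX.measure_incMin_nonneg hδ (j + k) 0]
  refine measure_mono ?_
  rintro ω ⟨h1, h2⟩
  rw [mem_ofPred_eq, le_incMin_iff] at h1 h2 ⊢
  intro i hi
  rcases le_total i j with hij | hij
  · exact h1 i hij
  · have h3 := h1 j le_rfl
    have h4 := h2 (i - j) (by omega)
    rw [show j + (i - j) = 0 + i by omega] at h4
    rw [zero_add j] at h3
    linarith

theorem IsLevy.walkMinLaw_Ici_pow_le (hX : IsLevy P ℱ X) {δ : ℝ} (hδ : 0 < δ) (m n : ℕ) :
    walkMinLaw (P.map (X δ)) m (Set.Ici 0) ^ n ≤ walkMinLaw (P.map (X δ)) (n * m) (Set.Ici 0) := by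
  have := hX.isProb
  induction n with
  | zero => simp [walkMinLaw]
  | succ n ih =>
    rw [pow_succ, add_mul, one_mul]
    exact (mul_le_mul_left ih _).trans (hX.mul_walkMinLaw_Ici_le hδ _ _)

/-- The event that `j` is the first time at which the grid process attains its minimum over
`0, …, j`. -/
def recordSet (X : ℝ → Ω → ℝ) (δ : ℝ) (j : ℕ) : Set Ω :=
  {ω | ∀ i : ℕ, i < j → X ((j : ℝ) * δ) ω < X ((i : ℝ) * δ) ω}

theorem IsLevy.measurableSet_recordSet (hX : IsLevy P ℱ X) {δ : ℝ} (hδ : 0 < δ) (j : ℕ) :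
    MeasurableSet[ℱ ((j : ℝ) * δ)] (recordSet X δ j) := by
  have : recordSet X δ j = ⋂ i : ℕ, ⋂ _ : i < j,
      {ω | X ((j : ℝ) * δ) ω < X ((i : ℝ) * δ) ω} := by
    ext ω
    simp [recordSet]
  rw [this]
  exact MeasurableSet.iInter fun i => MeasurableSet.iInter fun hi =>
    measurableSet_lt (hX.measurable_grid hδ le_rfl) (hX.measurable_grid hδ hi.le)

theorem IsLevy.sum_recordSet_mul_le (hX : IsLevy P ℱ X) {δ : ℝ} (hδ : 0 < δ) (N : ℕ) :
    (∑ j ∈ Finset.range (N + 1), P (recordSet X δ j)) *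
      walkMinLaw (P.map (X δ)) N (Set.Ici 0) ≤ 1 := by
  have := hX.isProb
  let A : ℕ → Set Ω := fun j => recordSet X δ j ∩ {ω | 0 ≤ incMin X δ (N - j) j ω}
  have hAm : ∀ j, MeasurableSet (A j) := fun j =>
    (ℱ.le _ _ (hX.measurableSet_recordSet hδ j)).inter
      (hX.measurable_incMin hδ _ j measurableSet_Ici)
  have hlt : ∀ i j : ℕ, j ≤ N → i < j → Disjoint (A i) (A j) := by
    intro i j hj hij
    refine disjoint_left.2 fun ω hi hj' => ?_
    have h1 := hj'.1 i hij
    have h2 := (le_incMin_iff _ _ _ _ _ _).1 hi.2 (j - i) (by omega)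
    rw [show i + (j - i) = j by omega] at h2
    linarith
  have hdisj : PairwiseDisjoint (↑(Finset.range (N + 1))) A := by
    intro i hi j hj hij
    have hi' : i < N + 1 := by simpa using hi
    have hj' : j < N + 1 := by simpa using hj
    rcases lt_or_gt_of_ne hij with h | h
    · exact hlt i j (by omega) h
    · exact (hlt j i (by omega) h).symm
  calc _ = ∑ j ∈ Finset.range (N + 1),
        P (recordSet X δ j) * walkMinLaw (P.map (X δ)) N (Set.Ici 0) := Finset.sum_mul _ _ _
    _ ≤ ∑ j ∈ Finset.range (N + 1), P (A j) := by
        refine Finset.sum_le_sum fun j _ => ?_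
        rw [hX.measure_inter_incMin_nonneg hδ _ j (hX.measurableSet_recordSet hδ j)]
        exact mul_le_mul_right (hX.walkMinLaw_Ici_antitone hδ (Nat.sub_le N j)) _
    _ = P (⋃ j ∈ Finset.range (N + 1), A j) :=
        (measure_biUnion_finset hdisj fun j _ => hAm j).symm
    _ ≤ 1 := prob_le_one

theorem IsLevy.measure_forall_ge_le (hX : IsLevy P ℱ X) {δ : ℝ} (hδ : 0 < δ) (N L : ℕ) :
    P {ω | ∀ s, (N : ℝ) * δ ≤ s → 0 ≤ X s ω} ≤
      (∑ j ∈ Finset.range (N + 1), P (recordSet X δ j)) *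
        walkMinLaw (P.map (X δ)) L (Set.Ici 0) := by
  have hmono : P {ω | ∀ s, (N : ℝ) * δ ≤ s → 0 ≤ X s ω} ≤ P (⋃ j ∈ Finset.range (N + 1),
      recordSet X δ j ∩ {ω | 0 ≤ incMin X δ L j ω}) := by
    refine measure_mono_ae ?_
    filter_upwards [hX.zero] with ω h0 hω
    obtain ⟨l, hl, hlmin⟩ := Finset.exists_min_image (Finset.range (N + 1))
      (fun i : ℕ => X ((i : ℝ) * δ) ω) ⟨0, by simp⟩
    have hex : ∃ j : ℕ, j ≤ N ∧ ∀ i : ℕ, i ≤ N → X ((j : ℝ) * δ) ω ≤ X ((i : ℝ) * δ) ω :=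
      ⟨l, by simpa [Nat.lt_succ_iff] using hl, fun i hi => hlmin i (by simpa [Nat.lt_succ_iff])⟩
    obtain ⟨hjN, hjmin⟩ := Nat.find_spec hex
    have hfirst := fun i : ℕ => Nat.find_min (m := i) hex
    set j := Nat.find hex
    have hall : ∀ i : ℕ, X ((j : ℝ) * δ) ω ≤ X ((i : ℝ) * δ) ω := by
      intro i
      rcases le_total i N with hi | hi
      · exact hjmin i hi
      · have h1 := hjmin 0 N.zero_le
        rw [Nat.cast_zero, zero_mul, h0] at h1
        exact h1.trans (hω _ (mul_le_mul_of_nonneg_right (by exact_mod_cast hi) hδ.le))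
    refine mem_biUnion (x := j) (by simpa [Nat.lt_succ_iff] using hjN) ⟨fun i hi => ?_, ?_⟩
    · by_contra! hle
      exact hfirst i hi ⟨hi.le.trans hjN, fun k _ => hle.trans (hall k)⟩
    · rw [mem_ofPred_eq, le_incMin_iff]
      exact fun i _ => sub_nonneg.2 (hall _)
  refine hmono.trans ((measure_biUnion_finset_le _ _).trans (le_of_eq ?_))
  rw [Finset.sum_mul]
  exact Finset.sum_congr rfl fun j _ =>
    hX.measure_inter_incMin_nonneg hδ L j (hX.measurableSet_recordSet hδ j)

theorem IsLevy.mul_le_walkMinLaw_Ici (hX : IsLevy P ℱ X) {δ : ℝ} (hδ : 0 < δ) (N L : ℕ) :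
    P {ω | ∀ s, (N : ℝ) * δ ≤ s → 0 ≤ X s ω} * walkMinLaw (P.map (X δ)) N (Set.Ici 0) ≤
      walkMinLaw (P.map (X δ)) L (Set.Ici 0) := by
  calc _ ≤ (∑ j ∈ Finset.range (N + 1), P (recordSet X δ j)) *
        walkMinLaw (P.map (X δ)) L (Set.Ici 0) * walkMinLaw (P.map (X δ)) N (Set.Ici 0) :=
        mul_le_mul_left (hX.measure_forall_ge_le hδ N L) _
    _ = ((∑ j ∈ Finset.range (N + 1), P (recordSet X δ j)) *
        walkMinLaw (P.map (X δ)) N (Set.Ici 0)) * walkMinLaw (P.map (X δ)) L (Set.Ici 0) := by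
        rw [mul_right_comm]
    _ ≤ 1 * walkMinLaw (P.map (X δ)) L (Set.Ici 0) :=
        mul_le_mul_left (hX.sum_recordSet_mul_le hδ N) _
    _ = _ := one_mul _

theorem IsLevy.measure_runInf_nonneg_le (hX : IsLevy P ℱ X) {ε : ℝ} (hε : 0 < ε) (l : ℕ) :
    P {ω | 0 ≤ runInf X ε ω} ≤
      walkMinLaw (P.map (X (ε / ((l : ℝ) + 1)))) (l + 1) (Set.Ici 0) := by
  have hδ : 0 < ε / ((l : ℝ) + 1) := by positivity
  rw [← hX.measure_incMin_nonneg hδ (l + 1) 0]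
  refine measure_mono_ae ?_
  filter_upwards [hX.zero] with ω h0 hω
  refine (le_incMin_iff _ _ _ _ _ _).2 fun i hi => ?_
  rw [Nat.cast_zero, zero_mul, h0, sub_zero, zero_add]
  refine le_trans hω (hX.runInf_le ω (by positivity) ?_)
  have : (i : ℝ) ≤ (l : ℝ) + 1 := by exact_mod_cast hi
  calc (i : ℝ) * (ε / ((l : ℝ) + 1)) ≤ ((l : ℝ) + 1) * (ε / ((l : ℝ) + 1)) := by gcongr
    _ = ε := mul_div_cancel₀ _ (by positivity)

theorem IsLevy.forall_le_of_frequently_incMin (hX : IsLevy P ℱ X) {ε : ℝ} (hε : 0 < ε) {ω : Ω}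
    (h : ∀ k : ℕ, ∃ l, k ≤ l ∧ 0 ≤ incMin X (ε / ((l : ℝ) + 1)) ((l + 1) ^ 2) 0 ω) {t : ℝ}
    (ht : 0 ≤ t) : X 0 ω ≤ X t ω := by
  by_contra! hlt
  obtain ⟨η, hη, hη'⟩ := hX.exists_forall_Ico ω ht (gt_mem_nhds hlt)
  obtain ⟨k, hk⟩ := exists_nat_ge (max (ε / η) ((t + ε) / ε))
  obtain ⟨l, hkl, hl⟩ := h k
  have hl1 : (k : ℝ) < (l : ℝ) + 1 := by exact_mod_cast Nat.lt_succ_of_le hkl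
  have hlpos : 0 < (l : ℝ) + 1 := by positivity
  set δ := ε / ((l : ℝ) + 1) with hδdef
  have hδ : 0 < δ := by positivity
  have hδη : δ < η := by
    have h1 : ε / η < (l : ℝ) + 1 := ((le_max_left _ _).trans hk).trans_lt hl1
    rw [div_lt_iff₀ hη] at h1
    rw [hδdef, div_lt_iff₀ hlpos]
    linarith
  have hδε : δ ≤ ε := div_le_self hε.le (by linarith [(l.cast_nonneg : (0 : ℝ) ≤ l)])
  have htl : t + ε ≤ ((l : ℝ) + 1) * ε := by
    have h1 : (t + ε) / ε ≤ (l : ℝ) + 1 := ((le_max_right _ _).trans hk).trans hl1.le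
    exact (div_le_iff₀ hε).1 h1
  have h1 := Nat.lt_floor_add_one (t / δ)
  have h2 := Nat.floor_le (div_nonneg ht hδ.le)
  rw [div_lt_iff₀ hδ] at h1
  rw [le_div_iff₀ hδ] at h2
  have hi : ⌊t / δ⌋₊ + 1 ≤ (l + 1) ^ 2 := by
    have : ((⌊t / δ⌋₊ : ℝ) + 1) * δ ≤ (((l : ℝ) + 1) ^ 2) * δ := by
      have : (((l : ℝ) + 1) ^ 2) * δ = ((l : ℝ) + 1) * ε := by
        rw [hδdef]
        field_simp
      rw [this]
      linarith
    exact_mod_cast le_of_mul_le_mul_right this hδ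
  have h3 := (le_incMin_iff _ _ _ _ _ _).1 hl _ hi
  rw [Nat.cast_zero, zero_mul, zero_add, sub_nonneg] at h3
  push_cast at h3
  exact absurd h3 (not_le.2 (hη' _ h1.le (by linarith)))

theorem IsLevy.exists_measure_forall_ge_pos (hX : IsLevy P ℱ X)
    (hT : ∀ᵐ ω ∂P, Tendsto (fun t => X t ω) atTop atTop) {ε : ℝ} (hε : 0 < ε) :
    ∃ n : ℕ, P {ω | ∀ s, (n : ℝ) * ε ≤ s → 0 ≤ X s ω} ≠ 0 := by
  have := hX.isProb
  by_contra! h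
  have h0 := measure_iUnion_null h
  have hall : ∀ᵐ ω ∂P, ω ∈ ⋃ n : ℕ, {ω | ∀ s, (n : ℝ) * ε ≤ s → 0 ≤ X s ω} := by
    filter_upwards [hT] with ω hω
    obtain ⟨t, ht⟩ := eventually_atTop.1 (tendsto_atTop.1 hω 0)
    obtain ⟨n, hn⟩ := exists_nat_ge (t / ε)
    exact mem_iUnion.2 ⟨n, fun s hs => ht s (((div_le_iff₀ hε).1 hn).trans hs)⟩
  have hone := prob_compl_eq_zero_iff₀ (NullMeasurableSet.of_null h0) |>.1 hall
  exact zero_ne_one (h0.symm.trans hone)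

theorem IsLevy.measure_infAll_nonneg_ne_zero (hX : IsLevy P ℱ X)
    (hT : ∀ᵐ ω ∂P, Tendsto (fun t => X t ω) atTop atTop) {ε : ℝ} (hε : 0 < ε)
    (hq : P {ω | 0 ≤ runInf X ε ω} ≠ 0) : P {ω | 0 ≤ infAll X ω} ≠ 0 := by
  have := hX.isProb
  obtain ⟨n, hn⟩ := hX.exists_measure_forall_ge_pos hT hε
  set κ := P {ω | ∀ s, (n : ℝ) * ε ≤ s → 0 ≤ X s ω} * P {ω | 0 ≤ runInf X ε ω} ^ n with hκ
  have hκ0 : κ ≠ 0 := mul_ne_zero hn (pow_ne_zero n hq)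
  let E : ℕ → Set Ω := fun l => {ω | 0 ≤ incMin X (ε / ((l : ℝ) + 1)) ((l + 1) ^ 2) 0 ω}
  have hδ : ∀ l : ℕ, 0 < ε / ((l : ℝ) + 1) := fun l => by positivity
  have hEm : ∀ l, MeasurableSet (E l) := fun l =>
    hX.measurable_incMin (hδ l) _ _ measurableSet_Ici
  have hE : ∀ l, κ ≤ P (E l) := by
    intro l
    have h1 := hX.mul_le_walkMinLaw_Ici (hδ l) (n * (l + 1)) ((l + 1) ^ 2)
    have h2 : ((n * (l + 1) : ℕ) : ℝ) * (ε / ((l : ℝ) + 1)) = n * ε := by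
      push_cast
      field_simp
    rw [h2] at h1
    simp only [E]
    rw [hX.measure_incMin_nonneg (hδ l)]
    refine le_trans (mul_le_mul_right ?_ _) h1
    exact (pow_le_pow_left₀ zero_le (hX.measure_runInf_nonneg_le hε l) n).trans
      (hX.walkMinLaw_Ici_pow_le (hδ l) (l + 1) n)
  let B : ℕ → Set Ω := fun k => ⋃ l ≥ k, E l
  have hB : Tendsto (fun k => P (B k)) atTop (nhds (P (⋂ k, B k))) :=
    tendsto_measure_iInter_atTop
      (fun k => (MeasurableSet.iUnion fun l => MeasurableSet.iUnion fun _ =>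
        hEm l).nullMeasurableSet)
      (fun j k hjk => iUnion₂_mono' fun l hl => ⟨l, hjk.trans hl, le_rfl⟩)
      ⟨0, measure_ne_top P _⟩
  have hκB : κ ≤ P (⋂ k, B k) := ge_of_tendsto' hB fun k =>
    (hE k).trans (measure_mono (subset_biUnion_of_mem (u := E) (le_refl k)))
  have hsub : P (⋂ k, B k) ≤ P {ω | 0 ≤ infAll X ω} := by
    refine measure_mono_ae ?_
    filter_upwards [hX.zero] with ω h0 hω
    have hfreq : ∀ k : ℕ, ∃ l, k ≤ l ∧ ω ∈ E l := by
      intro k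
      obtain ⟨l, hl, hω'⟩ := mem_iUnion₂.1 (mem_iInter.1 hω k)
      exact ⟨l, hl, hω'⟩
    refine le_csInf ⟨_, 0, le_refl (0 : ℝ), rfl⟩ ?_
    rintro _ ⟨t, ht, rfl⟩
    exact h0 ▸ hX.forall_le_of_frequently_incMin hε hfreq ht
  intro h
  rw [h] at hsub
  exact hκ0 (le_antisymm (hκB.trans hsub) zero_le)

theorem IsLevy.map_infAll_singleton_eq_zero_iff (hX : IsLevy P ℱ X)
    (hT : ∀ᵐ ω ∂P, Tendsto (fun t => X t ω) atTop atTop) :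
    P.map (infAll X) {0} = 0 ↔ ∀ᵐ ω ∂P, ω ∈ regularBelow X := by
  have hiff : P.map (infAll X) {0} = 0 ↔ ∀ᵐ ω ∂P, infAll X ω ≠ 0 := by
    rw [Measure.map_apply_of_aemeasurable (hX.aemeasurable_infAll hT)
      (measurableSet_singleton 0), ae_iff]
    simp [preimage]
  rw [hiff]
  constructor
  · intro h
    refine ae_mem_regularBelow fun ε hε => ⟨ε / 2, by positivity, by linarith, ?_⟩
    by_contra hneg
    refine hX.measure_infAll_nonneg_ne_zero hT (half_pos hε) ?_ ?_
    · simpa [ae_iff] using hneg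
    · rw [← nonpos_iff_eq_zero, ← ae_iff.1 h]
      refine measure_mono_ae ?_
      filter_upwards [hX.zero, hT] with ω h0 hω h1
      exact not_not.2 (le_antisymm (h0 ▸ hX.infAll_le hω le_rfl) h1)
  · intro h
    filter_upwards [h, hT] with ω h1 hω
    obtain ⟨t, ht0, -, ht⟩ := h1 1 one_pos
    exact ((hX.infAll_le hω ht0).trans_lt ht).ne

end Regularity

theorem stmt13 [m0 : MeasurableSpace Ω] (P : Measure Ω) (ℱ : Filtration ℝ m0)
    (X : ℝ → Ω → ℝ) (hX : IsLevy P ℱ X) (r K : ℝ) (hK : 0 < K)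
    (hr : 0 < r ∨ (r = 0 ∧ P {ω | Tendsto (fun t => X t ω) atTop atTop} = 1)) :
    HasDerivAt (fun x => putValue P ℱ X r K x)
      (-Real.exp (Real.log (K * mInf P X r))) (Real.log (K * mInf P X r)) ↔
      P (regularBelow X) = 1 := by
  have := hX.isProb
  rw [hX.measure_regularBelow_eq_one_iff]
  rcases hr with hr | ⟨rfl, hlim⟩
  · have := hX.isProbabilityMeasure_infLaw hr
    simp only [hX.putValue_eq_priceFn_infLaw hr hK, hX.mInf_eq_expMean_infLaw hr]
    rw [← hX.infLaw_singleton_eq_zero_iff hr]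
    exact hasDerivAt_priceFn_iff (hX.infLaw_ae_nonpos hr) hK
  · have hT := hX.ae_tendsto_atTop hlim
    have : IsProbabilityMeasure (P.map (infAll X)) :=
      Measure.isProbabilityMeasure_map (hX.aemeasurable_infAll hT)
    simp only [hX.putValue_zero_eq_priceFn hT hK, hX.mInf_zero_eq_expMean hT]
    rw [← hX.map_infAll_singleton_eq_zero_iff hT]
    exact hasDerivAt_priceFn_iff (hX.map_infAll_ae_nonpos hT) hK

end AKLevy
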